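/- arXiv:math/9707212 — 2 statements merged into one kernel-verified Lean document; each statement's English description precedes it below -/
import Mathlib

section
/- For every integer k ≥ 2, the homology of the complex of connected graphs Δ¹(k) vanishes in every degree i ≠ k−2, and H_{k−2}(Δ¹(k)) is a free abelian group of rank (k−1)!. -/
set_option autoImplicit false

/-!
Statement 0: For every integer k ≥ 2, the homology of the complex of connected
graphs Δ¹(k) vanishes in every degree i ≠ k−2, and H_{k−2}(Δ¹(k)) is a free
abelian group of rank (k−1)!.
-/

noncomputable section

open Finset

/-- Generators of degree `d` of the simplicial chain complex on the vertex set `V`: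
`(d+1)`-element subsets of `V`. -/
abbrev Gen (V : Type) (d : ℕ) : Type := {S : Finset V // S.card = d + 1}

/-- The degree-`d` chain group: the free abelian group on the `(d+1)`-element
subsets of `V`. -/
abbrev Chain (V : Type) (d : ℕ) : Type := Gen V d →₀ ℤ

/-- The simplicial boundary operator: `∂S = Σ_m (−1)^{m−1} (S − s_m)`, where
`s₁ < s₂ < …` are the elements of `S` (the sign of the summand removing `s`
is `(−1)` to the number of elements of `S` smaller than `s`).  In degree `0`
it is the zero map. -/
def bdry (V : Type) [LinearOrder V] (d : ℕ) :
    Chain V d →ₗ[ℤ] Chain V (d - 1) := by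
  classical
  exact Finsupp.lift (Chain V (d - 1)) ℤ (Gen V d) fun S =>
    ∑ s ∈ S.1, ((-1 : ℤ) ^ (S.1.filter fun t => t < s).card) •
      (if h : (S.1.erase s).card = (d - 1) + 1
        then Finsupp.single (⟨S.1.erase s, h⟩ : Gen V (d - 1)) (1 : ℤ) else 0)

/-- The subgroup of degree-`d` chains spanned by the "bad" faces, i.e. those not
satisfying the predicate `good`.  The quotient complex is the quotient of the
chain complex of the simplex by these subgroups. -/
def badChains (V : Type) (good : Finset V → Prop) (d : ℕ) : Submodule ℤ (Chain V d) :=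
  Submodule.span ℤ {x | ∃ S : Gen V d, ¬ good S.1 ∧ x = Finsupp.single S 1}

/-- Cycles of degree `d` of the quotient complex: chains whose boundary vanishes
in the quotient, i.e. lies in the span of the bad faces. -/
def cycles (V : Type) [LinearOrder V] (good : Finset V → Prop) (d : ℕ) :
    Submodule ℤ (Chain V d) :=
  Submodule.comap (bdry V d) (badChains V good (d - 1))

/-- The degree-`d` homology of the quotient complex: cycles modulo
(bad chains + boundaries). -/
abbrev homology (V : Type) [LinearOrder V] (good : Finset V → Prop) (d : ℕ) : Type :=
  (cycles V good d) ⧸ (Submodule.comap (cycles V good d).subtype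
    (badChains V good d ⊔ LinearMap.range (bdry V (d + 1))))

/-- Edges of the complete graph on `Fin k`: unordered pairs of distinct nodes,
encoded as ordered pairs `(a, b)` with `a < b`. -/
abbrev Edge (k : ℕ) : Type := {p : Fin k × Fin k // p.1 < p.2}

/-- The lexicographic order on edges induced by the order of the nodes. -/
instance (k : ℕ) : LinearOrder (Edge k) :=
  LinearOrder.lift' (fun e => toLex e.1) fun a b h => Subtype.ext (toLex.injective h)

/-- The graph on the `k` nodes `Fin k` with the given edge set. -/
def graphOf (k : ℕ) (S : Finset (Edge k)) : SimpleGraph (Fin k) :=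
  SimpleGraph.fromEdgeSet {q | ∃ p ∈ S, q = s(p.1.1, p.1.2)}

/-- A set of edges is good for `Δ¹(k)` iff the corresponding graph on all `k`
nodes is connected. -/
def IsConn (k : ℕ) (S : Finset (Edge k)) : Prop := (graphOf k S).Connected

/-- The sign attached to removing or inserting `s` in `S`. -/
def faceSign {V : Type} [LinearOrder V] (s : V) (S : Finset V) : ℤ :=
  (-1) ^ (S.filter fun t => t < s).card

/-- The simplicial boundary on the ungraded chain group, augmented by the empty face. -/
def totalBdry (V : Type) [LinearOrder V] : (Finset V →₀ ℤ) →ₗ[ℤ] (Finset V →₀ ℤ) :=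
  Finsupp.linearCombination ℤ fun S =>
    ∑ s ∈ S, faceSign s S • Finsupp.single (S.erase s) (1 : ℤ)

/-- The operator coning off all faces satisfying `p` with the vertex `e`. -/
def coneOn {V : Type} [LinearOrder V] (p : Finset V → Prop) [DecidablePred p] (e : V) :
    (Finset V →₀ ℤ) →ₗ[ℤ] (Finset V →₀ ℤ) :=
  Finsupp.linearCombination ℤ fun S =>
    if p S ∧ e ∉ S then faceSign e S • Finsupp.single (insert e S) (1 : ℤ) else 0

section Cone

variable {V : Type} [LinearOrder V]

lemma faceSign_mul_self (s : V) (S : Finset V) : faceSign s S * faceSign s S = 1 := by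
  rw [faceSign, ← mul_pow]; simp

lemma faceSign_insert_of_lt {s t : V} {S : Finset V} (ht : t ∉ S) (h : t < s) :
    faceSign s (insert t S) = - faceSign s S := by
  rw [faceSign, Finset.filter_insert, if_pos h, Finset.card_insert_of_notMem (by simp [ht]),
    pow_succ, faceSign]
  ring

lemma faceSign_insert_of_le {s t : V} (S : Finset V) (h : s ≤ t) :
    faceSign s (insert t S) = faceSign s S := by
  rw [faceSign, Finset.filter_insert, if_neg (not_lt.2 h), faceSign]

lemma faceSign_erase_self (s : V) (S : Finset V) : faceSign s (S.erase s) = faceSign s S := by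
  by_cases hs : s ∈ S
  · conv_rhs => rw [← Finset.insert_erase hs, faceSign_insert_of_le _ le_rfl]
  · rw [Finset.erase_eq_of_notMem hs]

lemma faceSign_swap {s e : V} {S : Finset V} (hs : s ∈ S) (he : e ∉ S) :
    faceSign e S * faceSign s (insert e S) = - (faceSign s S * faceSign e (S.erase s)) := by
  have hse : s ≠ e := fun h => he (h ▸ hs)
  have hS := Finset.insert_erase hs
  rcases lt_or_gt_of_ne hse with h | h
  · rw [faceSign_insert_of_le _ h.le]
    have := faceSign_insert_of_lt (Finset.notMem_erase s S) h
    rw [hS] at this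
    rw [this]; ring
  · rw [faceSign_insert_of_lt he h]
    have := faceSign_insert_of_le (S.erase s) h.le
    rw [hS] at this
    rw [this]; ring

lemma totalBdry_single (S : Finset V) : totalBdry V (Finsupp.single S 1) =
    ∑ s ∈ S, faceSign s S • Finsupp.single (S.erase s) (1 : ℤ) := by
  simp [totalBdry]

lemma coneOn_single (p : Finset V → Prop) [DecidablePred p] (e : V) (S : Finset V) :
    coneOn p e (Finsupp.single S 1) =
      if p S ∧ e ∉ S then faceSign e S • Finsupp.single (insert e S) (1 : ℤ) else 0 := by
  simp [coneOn]

/-- At a face `S` in `p`, the restricted cone operator is a contraction up to the faces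
`insert e (S.erase s)` for which `S.erase s` is not in `p`. -/
lemma totalBdry_coneOn_add (p : Finset V → Prop) [DecidablePred p] (e : V) (S : Finset V)
    (hS : p S) (he : e ∈ S → p (S.erase e)) :
    totalBdry V (coneOn p e (Finsupp.single S 1)) + coneOn p e (totalBdry V (Finsupp.single S 1)) =
      Finsupp.single S 1 + if e ∈ S then 0 else
        ∑ s ∈ S with ¬ p (S.erase s), (faceSign e S * faceSign s (insert e S)) •
          Finsupp.single (insert e (S.erase s)) (1 : ℤ) := by
  by_cases heS : e ∈ S
  · rw [coneOn_single, if_neg (by simp [heS]), map_zero, zero_add, if_pos heS, add_zero,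
      totalBdry_single, map_sum, Finset.sum_eq_single_of_mem e heS]
    · rw [map_smul, coneOn_single, if_pos ⟨he heS, Finset.notMem_erase e S⟩, faceSign_erase_self,
        smul_smul, faceSign_mul_self, one_smul, Finset.insert_erase heS]
    · intro s _ hse
      rw [map_smul, coneOn_single, if_neg (by simp [heS, hse.symm]), smul_zero]
  · have hne : ∀ s ∈ S, s ≠ e := fun s hs h => heS (h ▸ hs)
    rw [coneOn_single, if_pos ⟨hS, heS⟩, if_neg heS, map_smul, totalBdry_single,
      Finset.sum_insert heS, faceSign_insert_of_le _ le_rfl, Finset.erase_insert heS, smul_add,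
      smul_smul, faceSign_mul_self, one_smul, totalBdry_single, map_sum, add_assoc,
      Finset.smul_sum, ← Finset.sum_add_distrib, Finset.sum_filter]
    congr 1
    refine Finset.sum_congr rfl fun s hs => ?_
    rw [map_smul, coneOn_single, Finset.erase_insert_of_ne (hne s hs).symm, smul_smul]
    have hes : e ∉ S.erase s := fun h => heS (Finset.mem_of_mem_erase h)
    by_cases hp : p (S.erase s)
    · rw [if_pos ⟨hp, hes⟩, if_neg (not_not.2 hp), faceSign_swap hs heS, smul_smul, ← add_smul]
      simp
    · simp [hp]

lemma totalBdry_totalBdry (x : Finset V →₀ ℤ) : totalBdry V (totalBdry V x) = 0 := by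
  classical
  suffices h : totalBdry V ∘ₗ totalBdry V = 0 from LinearMap.congr_fun h x
  have key : ∀ (e : V) (x : Finset V →₀ ℤ),
      totalBdry V (coneOn (fun _ => True) e x) = x - coneOn (fun _ => True) e (totalBdry V x) := by
    intro e x
    rw [eq_sub_iff_add_eq]
    suffices h : totalBdry V ∘ₗ coneOn (fun _ => True) e + coneOn (fun _ => True) e ∘ₗ totalBdry V =
      LinearMap.id from LinearMap.congr_fun h x
    ext1 S
    ext1
    simpa using totalBdry_coneOn_add (fun _ => True) e S trivial fun _ => trivial
  ext1 S
  ext1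
  simp only [LinearMap.comp_apply, Finsupp.lsingle_apply, LinearMap.zero_apply]
  induction S using Finset.induction_on with
  | empty => simp [totalBdry_single]
  | insert e S he ih =>
    have h1 : Finsupp.single (insert e S) (1 : ℤ) =
        faceSign e S • coneOn (fun _ => True) e (Finsupp.single S 1) := by
      rw [coneOn_single, if_pos ⟨trivial, he⟩, smul_smul, faceSign_mul_self, one_smul]
    rw [h1, map_smul, map_smul, key, map_sub, key, ih]
    simp

/-- A linear map sends chains supported in `s` to `p` as soon as it does so on generators. -/
lemma map_mem_of_mem_supported {α M : Type*} [AddCommGroup M] (f : (α →₀ ℤ) →ₗ[ℤ] M)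
    {s : Set α} {p : Submodule ℤ M} (h : ∀ a ∈ s, f (Finsupp.single a 1) ∈ p) {x : α →₀ ℤ}
    (hx : x ∈ Finsupp.supported ℤ ℤ s) : f x ∈ p := by
  rw [Finsupp.supported_eq_span_single] at hx
  have : Submodule.span ℤ ((fun a => Finsupp.single a (1 : ℤ)) '' s) ≤ p.comap f := by
    rw [Submodule.span_le]
    rintro _ ⟨a, ha, rfl⟩
    exact h a ha
  exact this hx

lemma totalBdry_mem_supported {s : Set (Finset V)} (hs : ∀ S T, S ⊆ T → T ∈ s → S ∈ s)
    {x : Finset V →₀ ℤ} (hx : x ∈ Finsupp.supported ℤ ℤ s) :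
    totalBdry V x ∈ Finsupp.supported ℤ ℤ s := by
  refine map_mem_of_mem_supported _ (fun S hS => ?_) hx
  rw [totalBdry_single]
  exact Submodule.sum_mem _ fun t _ => Submodule.smul_mem _ _
    (Finsupp.single_mem_supported _ _ (hs _ _ (Finset.erase_subset _ _) hS))

end Cone

/-- A discrete Morse matching on the faces satisfying `good`: a monotone rank such that for each
positive value the faces of that rank are matched by toggling a fixed vertex. Faces of rank zero
are critical. -/
structure IsToggleRank {V : Type} [DecidableEq V] (good : Finset V → Prop)
    (r : Finset V → ℕ) : Prop where
  good_mono : ∀ S T, S ⊆ T → good S → good T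
  rank_mono : ∀ S T, S ⊆ T → r S ≤ r T
  toggle : ∀ n, ∃ e : V, ∀ S, good S → r S = n + 1 →
    (good (insert e S) ∧ r (insert e S) = n + 1) ∧ (good (S.erase e) ∧ r (S.erase e) = n + 1)

namespace IsToggleRank

variable {V : Type} [LinearOrder V] {good : Finset V → Prop} {r : Finset V → ℕ}

lemma totalBdry_mem (H : IsToggleRank good r) {n : ℕ} {x : Finset V →₀ ℤ}
    (hx : x ∈ Finsupp.supported ℤ ℤ {S | good S → r S ≤ n}) :
    totalBdry V x ∈ Finsupp.supported ℤ ℤ {S | good S → r S ≤ n} :=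
  totalBdry_mem_supported (s := {S | good S → r S ≤ n})
    (fun S T h hT hS => (H.rank_mono S T h).trans (hT (H.good_mono S T h hS))) hx

lemma totalBdry_mem_not_good (H : IsToggleRank good r) {x : Finset V →₀ ℤ}
    (hx : x ∈ Finsupp.supported ℤ ℤ {S | ¬ good S}) :
    totalBdry V x ∈ Finsupp.supported ℤ ℤ {S | ¬ good S} :=
  totalBdry_mem_supported (s := {S | ¬ good S})
    (fun S T h hT hS => hT (H.good_mono S T h hS)) hx

lemma exists_sub_totalBdry_mem_of_succ (H : IsToggleRank good r) {n : ℕ} {w : Finset V →₀ ℤ}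
    (hw : w ∈ Finsupp.supported ℤ ℤ {S | good S → r S ≤ n + 1})
    (hDw : totalBdry V w ∈ Finsupp.supported ℤ ℤ {S | good S → r S ≤ n}) :
    ∃ u, w - totalBdry V u ∈ Finsupp.supported ℤ ℤ {S | good S → r S ≤ n} := by
  classical
  obtain ⟨e, he⟩ := H.toggle n
  let p : Finset V → Prop := fun S => good S ∧ r S = n + 1
  have cone_eq_zero : ∀ x ∈ Finsupp.supported ℤ ℤ {S | good S → r S ≤ n}, coneOn p e x = 0 := by
    intro x hx
    rw [← Submodule.mem_bot ℤ]
    refine map_mem_of_mem_supported _ (fun S hS => ?_) hx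
    rw [Submodule.mem_bot, coneOn_single, if_neg]
    rintro ⟨⟨hg, hr⟩, -⟩
    have := hS hg
    omega
  refine ⟨coneOn p e w, ?_⟩
  let f := LinearMap.id - totalBdry V ∘ₗ coneOn p e - coneOn p e ∘ₗ totalBdry V
  have hf : w - totalBdry V (coneOn p e w) = f w := by
    simp [f, cone_eq_zero _ hDw]
  rw [hf]
  refine map_mem_of_mem_supported f (fun S hS => ?_) hw
  by_cases hp : p S
  · have h := totalBdry_coneOn_add p e S hp fun _ => (he S hp.1 hp.2).2
    have hfS : f (Finsupp.single S 1) = - if e ∈ S then 0 else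
        ∑ s ∈ S with ¬ p (S.erase s), (faceSign e S * faceSign s (insert e S)) •
          Finsupp.single (insert e (S.erase s)) (1 : ℤ) := by
      simp only [f, LinearMap.sub_apply, LinearMap.comp_apply, LinearMap.id_apply]
      rw [sub_sub, h, sub_add_cancel_left]
    rw [hfS]
    refine Submodule.neg_mem _ ?_
    split_ifs with heS
    · exact Submodule.zero_mem _
    · refine Submodule.sum_mem _ fun s hs => Submodule.smul_mem _ _
        (Finsupp.single_mem_supported _ _ fun hg => ?_)
      by_contra hlt
      have hle := H.rank_mono _ _ (Finset.insert_subset_insert e (Finset.erase_subset s S))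
      rw [(he S hp.1 hp.2).1.2] at hle
      have := (he _ hg (by omega)).2
      rw [Finset.erase_insert fun h => heS (Finset.mem_of_mem_erase h)] at this
      exact (Finset.mem_filter.1 hs).2 this
  · have hS' : Finsupp.single S (1 : ℤ) ∈ Finsupp.supported ℤ ℤ {S | good S → r S ≤ n} := by
      refine Finsupp.single_mem_supported _ _ fun hg => ?_
      have h1 := hS hg
      have h2 : r S ≠ n + 1 := fun h => hp ⟨hg, h⟩
      omega
    have hfS : f (Finsupp.single S 1) = Finsupp.single S 1 := by
      simp [f, cone_eq_zero _ hS', cone_eq_zero _ (H.totalBdry_mem hS')]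
    rwa [hfS]

/-- A chain whose boundary is critical modulo bad faces is itself critical modulo bad faces and
boundaries. -/
lemma exists_sub_totalBdry_mem (H : IsToggleRank good r) (w : Finset V →₀ ℤ)
    (hDw : totalBdry V w ∈ Finsupp.supported ℤ ℤ {S | good S → r S ≤ 0}) :
    ∃ u, w - totalBdry V u ∈ Finsupp.supported ℤ ℤ {S | good S → r S ≤ 0} := by
  suffices h : ∀ n, ∀ w ∈ Finsupp.supported ℤ ℤ {S | good S → r S ≤ n},
      totalBdry V w ∈ Finsupp.supported ℤ ℤ {S | good S → r S ≤ 0} →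
      ∃ u, w - totalBdry V u ∈ Finsupp.supported ℤ ℤ {S | good S → r S ≤ 0} from
    h (w.support.sup r) w (fun S hS _ => Finset.le_sup hS) hDw
  intro n
  induction n with
  | zero => exact fun w hw _ => ⟨0, by simpa using hw⟩
  | succ n ih =>
    intro w hw hDw
    obtain ⟨u, hu⟩ := H.exists_sub_totalBdry_mem_of_succ hw
      (Finsupp.supported_mono (fun S hS hg => (hS hg).trans (Nat.zero_le n)) hDw)
    obtain ⟨u', hu'⟩ := ih _ hu (by rwa [map_sub, totalBdry_totalBdry, sub_zero])
    exact ⟨u + u', by rwa [map_add, ← sub_sub]⟩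

end IsToggleRank

section Graded

variable {V : Type}

/-- The inclusion of the degree-`d` chains into the ungraded chain group. -/
def chainEmb (V : Type) (d : ℕ) : Chain V d →ₗ[ℤ] (Finset V →₀ ℤ) :=
  Finsupp.lmapDomain ℤ ℤ Subtype.val

/-- The projection of the ungraded chain group to the degree-`d` chains. -/
def chainProj (V : Type) (d : ℕ) : (Finset V →₀ ℤ) →ₗ[ℤ] Chain V d :=
  Finsupp.lcomapDomain Subtype.val Subtype.val_injective

lemma chainProj_apply (d : ℕ) (x : Finset V →₀ ℤ) (S : Gen V d) : chainProj V d x S = x S.1 :=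
  rfl

lemma chainEmb_apply (d : ℕ) (x : Chain V d) (S : Gen V d) : chainEmb V d x S.1 = x S :=
  Finsupp.mapDomain_apply Subtype.val_injective x S

lemma chainProj_chainEmb (d : ℕ) (x : Chain V d) : chainProj V d (chainEmb V d x) = x := by
  ext S
  rw [chainProj_apply, chainEmb_apply]

lemma chainEmb_single (d : ℕ) (S : Gen V d) :
    chainEmb V d (Finsupp.single S 1) = Finsupp.single S.1 1 :=
  Finsupp.mapDomain_single

lemma chainProj_mem_supported {d : ℕ} {p : Finset V → Prop} {x : Finset V →₀ ℤ}
    (hx : x ∈ Finsupp.supported ℤ ℤ {S | p S}) :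
    chainProj V d x ∈ Finsupp.supported ℤ ℤ {S : Gen V d | p S.1} := by
  rw [Finsupp.mem_supported'] at hx ⊢
  exact fun S hS => hx S.1 hS

lemma chainEmb_mem_supported_iff {d : ℕ} {p : Finset V → Prop} {x : Chain V d} :
    chainEmb V d x ∈ Finsupp.supported ℤ ℤ {S | p S} ↔
      x ∈ Finsupp.supported ℤ ℤ {S : Gen V d | p S.1} := by
  refine ⟨fun h => ?_, fun h => ?_⟩
  · rw [← chainProj_chainEmb d x]
    exact chainProj_mem_supported h
  · refine map_mem_of_mem_supported _ (fun S hS => ?_) h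
    rw [chainEmb_single]
    exact Finsupp.single_mem_supported _ _ hS

lemma badChains_eq_supported (good : Finset V → Prop) (d : ℕ) :
    badChains V good d = Finsupp.supported ℤ ℤ {S : Gen V d | ¬ good S.1} := by
  rw [badChains, Finsupp.supported_eq_span_single]
  congr 1
  ext x
  simp [eq_comm]

lemma supported_critical_eq_badChains {good : Finset V → Prop} {r : Finset V → ℕ} {N d : ℕ}
    (hcrit : ∀ S, good S → r S = 0 → S.card = N + 1)
    (hd : d ≠ N) :
    Finsupp.supported ℤ ℤ {S : Gen V d | good S.1 → r S.1 ≤ 0} = badChains V good d := by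
  rw [badChains_eq_supported]
  congr 1
  ext S
  refine ⟨fun h hg => hd ?_, fun h hg => absurd hg h⟩
  have := hcrit S.1 hg (Nat.le_zero.1 (h hg))
  rw [S.2] at this
  omega

lemma chainProj_single_of_card_ne {d : ℕ} {S : Finset V} (h : S.card ≠ d + 1) :
    chainProj V d (Finsupp.single S 1) = 0 := by
  ext T
  have hT : T.1 ≠ S := fun hT => h (hT ▸ T.2)
  rw [chainProj_apply, Finsupp.single_eq_of_ne hT, Finsupp.zero_apply]

variable [LinearOrder V]

lemma bdry_single (d : ℕ) (S : Gen V d) : bdry V d (Finsupp.single S 1) =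
    ∑ s ∈ S.1, faceSign s S.1 • chainProj V (d - 1) (Finsupp.single (S.1.erase s) 1) := by
  have h1 : ∀ (T : Finset V), (if h : T.card = (d - 1) + 1
        then Finsupp.single (⟨T, h⟩ : Gen V (d - 1)) (1 : ℤ) else 0) =
      chainProj V (d - 1) (Finsupp.single T 1) := by
    intro T
    split_ifs with h
    · rw [← chainProj_chainEmb (d - 1) (Finsupp.single _ 1), chainEmb_single]
    · rw [chainProj_single_of_card_ne h]
  simp only [← h1]
  simp [bdry, faceSign]

lemma bdry_zero : bdry V 0 = 0 := by
  ext1 S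
  ext1
  simp only [LinearMap.comp_apply, Finsupp.lsingle_apply, LinearMap.zero_apply]
  rw [bdry_single]
  refine Finset.sum_eq_zero fun s hs => ?_
  rw [chainProj_single_of_card_ne, smul_zero]
  rw [Finset.card_erase_of_mem hs, S.2]
  simp

/-- The boundary operator from degree `d + 1` to degree `d`. -/
def bdrySucc (V : Type) [LinearOrder V] (d : ℕ) : Chain V (d + 1) →ₗ[ℤ] Chain V d :=
  bdry V (d + 1)

lemma bdrySucc_single (d : ℕ) (S : Gen V (d + 1)) : bdrySucc V d (Finsupp.single S 1) =
    ∑ s ∈ S.1, faceSign s S.1 • chainProj V d (Finsupp.single (S.1.erase s) 1) :=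
  bdry_single (d + 1) S

lemma chainProj_totalBdry (d : ℕ) (x : Finset V →₀ ℤ) :
    chainProj V d (totalBdry V x) = bdrySucc V d (chainProj V (d + 1) x) := by
  suffices h : chainProj V d ∘ₗ totalBdry V = bdrySucc V d ∘ₗ chainProj V (d + 1) from
    LinearMap.congr_fun h x
  ext1 S
  ext1
  simp only [LinearMap.comp_apply, Finsupp.lsingle_apply]
  rw [totalBdry_single]
  simp only [map_sum, map_smul]
  by_cases hS : S.card = d + 1 + 1
  · have h2 : Finsupp.single S (1 : ℤ) = chainEmb V (d + 1) (Finsupp.single ⟨S, hS⟩ 1) :=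
      (chainEmb_single (d + 1) (⟨S, hS⟩ : Gen V (d + 1))).symm
    rw [h2, chainProj_chainEmb, bdrySucc_single]
  · rw [chainProj_single_of_card_ne hS, map_zero]
    refine Finset.sum_eq_zero fun s hs => ?_
    rw [chainProj_single_of_card_ne, smul_zero]
    have := Finset.card_erase_add_one hs
    omega

lemma chainEmb_bdrySucc (d : ℕ) (x : Chain V (d + 1)) :
    chainEmb V d (bdrySucc V d x) = totalBdry V (chainEmb V (d + 1) x) := by
  suffices h : chainEmb V d ∘ₗ bdrySucc V d = totalBdry V ∘ₗ chainEmb V (d + 1) from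
    LinearMap.congr_fun h x
  ext1 S
  ext1
  simp only [LinearMap.comp_apply, Finsupp.lsingle_apply]
  rw [chainEmb_single, totalBdry_single, bdrySucc_single, map_sum]
  refine Finset.sum_congr rfl fun s hs => ?_
  have hc : (S.1.erase s).card = d + 1 := by rw [Finset.card_erase_of_mem hs, S.2]; rfl
  rw [map_smul, ← chainEmb_single d ⟨_, hc⟩]
  congr 2
  exact chainProj_chainEmb d _

lemma mem_cycles_iff {good : Finset V → Prop} (h0 : ¬ good ∅) {d : ℕ} {x : Chain V d} :
    x ∈ cycles V good d ↔
      totalBdry V (chainEmb V d x) ∈ Finsupp.supported ℤ ℤ {S | ¬ good S} := by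
  rw [cycles, Submodule.mem_comap, badChains_eq_supported]
  cases d with
  | zero =>
    rw [bdry_zero]
    refine iff_of_true (Submodule.zero_mem _) ?_
    refine map_mem_of_mem_supported (totalBdry V ∘ₗ chainEmb V 0) (s := Set.univ)
      (fun S _ => ?_) (by simp)
    rw [LinearMap.comp_apply, chainEmb_single, totalBdry_single]
    refine Submodule.sum_mem _ fun s hs => Submodule.smul_mem _ _
      (Finsupp.single_mem_supported _ _ ?_)
    have : S.1.erase s = ∅ := by
      rw [← Finset.card_eq_zero, Finset.card_erase_of_mem hs, S.2]
    rw [this]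
    exact h0
  | succ d => rw [← chainEmb_bdrySucc, chainEmb_mem_supported_iff]; rfl

end Graded

namespace IsToggleRank

variable {V : Type} [LinearOrder V] {good : Finset V → Prop} {r : Finset V → ℕ}

lemma exists_sub_bdrySucc_mem (H : IsToggleRank good r) {d : ℕ} (x : Chain V d)
    (hx : totalBdry V (chainEmb V d x) ∈ Finsupp.supported ℤ ℤ {S | good S → r S ≤ 0}) :
    ∃ u, x - bdrySucc V d u ∈
      Finsupp.supported ℤ ℤ {S : Gen V d | good S.1 → r S.1 ≤ 0} := by
  obtain ⟨u, hu⟩ := H.exists_sub_totalBdry_mem _ hx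
  refine ⟨chainProj V (d + 1) u, ?_⟩
  have := chainProj_mem_supported (d := d) (p := fun S => good S → r S ≤ 0) hu
  rwa [map_sub, chainProj_chainEmb, chainProj_totalBdry] at this

lemma exists_sub_bdrySucc_mem_of_mem_cycles (H : IsToggleRank good r) (h0 : ¬ good ∅) {d : ℕ}
    {x : Chain V d} (hx : x ∈ cycles V good d) :
    ∃ u, x - bdrySucc V d u ∈
      Finsupp.supported ℤ ℤ {S : Gen V d | good S.1 → r S.1 ≤ 0} :=
  H.exists_sub_bdrySucc_mem x
    (Finsupp.supported_mono (fun _ hS hg => absurd hg hS) ((mem_cycles_iff h0).1 hx))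

theorem subsingleton_homology (H : IsToggleRank good r) (h0 : ¬ good ∅) {N d : ℕ}
    (hcrit : ∀ S, good S → r S = 0 → S.card = N + 1) (hd : d ≠ N) :
    Subsingleton (homology V good d) := by
  rw [Submodule.Quotient.subsingleton_iff, eq_top_iff]
  rintro ⟨x, hx⟩ -
  obtain ⟨u, hu⟩ := H.exists_sub_bdrySucc_mem_of_mem_cycles h0 hx
  rw [supported_critical_eq_badChains hcrit hd] at hu
  exact Submodule.mem_sup.2 ⟨_, hu, _, ⟨u, rfl⟩, sub_add_cancel _ _⟩

theorem nonempty_homology_equiv (H : IsToggleRank good r) (h0 : ¬ good ∅) {N : ℕ}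
    (hcrit : ∀ S, good S → r S = 0 → S.card = N + 1)
    (hcard : ∀ S, good S → N + 1 ≤ S.card) :
    Nonempty (homology V good N ≃ₗ[ℤ] ({S // good S ∧ r S = 0} →₀ ℤ)) := by
  let g : {S // good S ∧ r S = 0} → Gen V N := fun S => ⟨S.1, hcrit S.1 S.2.1 S.2.2⟩
  have hg : Function.Injective g := fun S T h => Subtype.ext (congrArg (fun U => U.1) h)
  have hcyc : ∀ x, Finsupp.lmapDomain ℤ ℤ g x ∈ cycles V good N := by
    intro x
    rw [mem_cycles_iff h0]
    refine map_mem_of_mem_supported (totalBdry V ∘ₗ chainEmb V N ∘ₗ Finsupp.lmapDomain ℤ ℤ g)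
      (s := Set.univ) (fun S _ => ?_) (by simp)
    simp only [LinearMap.comp_apply, Finsupp.lmapDomain_apply, Finsupp.mapDomain_single]
    rw [chainEmb_single, totalBdry_single]
    refine Submodule.sum_mem _ fun s hs => Submodule.smul_mem _ _
      (Finsupp.single_mem_supported _ _ fun hgood => ?_)
    have h1 := hcard _ hgood
    rw [Finset.card_erase_of_mem hs, (g S).2] at h1
    omega
  let f := Submodule.mkQ (Submodule.comap (cycles V good N).subtype
      (badChains V good N ⊔ LinearMap.range (bdrySucc V N))) ∘ₗ
    LinearMap.codRestrict (cycles V good N) (Finsupp.lmapDomain ℤ ℤ g) hcyc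
  refine ⟨(LinearEquiv.ofBijective f ⟨?_, ?_⟩).symm⟩
  · rw [← LinearMap.ker_eq_bot, LinearMap.ker_eq_bot']
    intro x hx
    have hx' := (Submodule.Quotient.mk_eq_zero _).1 hx
    rw [Submodule.mem_comap, Submodule.subtype_apply, LinearMap.codRestrict_apply] at hx'
    obtain ⟨b, hb, _, ⟨y, rfl⟩, hby⟩ := Submodule.mem_sup.1 hx'
    rw [badChains_eq_supported] at hb
    have hcritx : Finsupp.lmapDomain ℤ ℤ g x ∈
        Finsupp.supported ℤ ℤ {S : Gen V N | good S.1 → r S.1 ≤ 0} := by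
      refine map_mem_of_mem_supported _ (s := Set.univ) (fun S _ => ?_) (by simp)
      rw [Finsupp.lmapDomain_apply, Finsupp.mapDomain_single]
      exact Finsupp.single_mem_supported _ _ fun _ => S.2.2.le
    have hy : bdrySucc V N y ∈
        Finsupp.supported ℤ ℤ {S : Gen V N | good S.1 → r S.1 ≤ 0} := by
      rw [← sub_eq_of_eq_add' hby.symm]
      exact Submodule.sub_mem _ hcritx
        (Finsupp.supported_mono (fun S hS hgood => absurd hgood hS) hb)
    obtain ⟨u, hu⟩ := H.exists_sub_bdrySucc_mem y (by
      rw [← chainEmb_bdrySucc]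
      exact (chainEmb_mem_supported_iff (p := fun S => good S → r S ≤ 0)).2 hy)
    rw [supported_critical_eq_badChains hcrit (Nat.succ_ne_self N), badChains_eq_supported] at hu
    have hDy : bdrySucc V N y ∈ Finsupp.supported ℤ ℤ {S : Gen V N | ¬ good S.1} := by
      have h1 := H.totalBdry_mem_not_good
        ((chainEmb_mem_supported_iff (p := fun S => ¬ good S)).2 hu)
      rw [map_sub, map_sub, chainEmb_bdrySucc, totalBdry_totalBdry, sub_zero, ← chainEmb_bdrySucc] at h1
      exact (chainEmb_mem_supported_iff (p := fun S => ¬ good S)).1 h1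
    have hfx := Submodule.add_mem _ hb hDy
    rw [hby, Finsupp.mem_supported'] at hfx
    ext S
    have := hfx (g S) (fun h => h S.2.1)
    rwa [Finsupp.lmapDomain_apply, Finsupp.mapDomain_apply hg] at this
  · intro q
    obtain ⟨⟨x, hx⟩, rfl⟩ := Submodule.mkQ_surjective _ q
    obtain ⟨u, hu⟩ := H.exists_sub_bdrySucc_mem_of_mem_cycles h0 hx
    set c := x - bdrySucc V N u with hc
    refine ⟨Finsupp.lcomapDomain (R := ℤ) g hg c, ?_⟩
    rw [eq_comm]
    refine (Submodule.Quotient.eq _).2 ?_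
    rw [Submodule.mem_comap]
    refine Submodule.mem_sup.2
      ⟨c - Finsupp.lmapDomain ℤ ℤ g (Finsupp.lcomapDomain (R := ℤ) g hg c), ?_, _, ⟨u, rfl⟩, ?_⟩
    · rw [badChains_eq_supported, Finsupp.mem_supported']
      intro S hS
      have hS : good S.1 := not_not.1 hS
      rw [Finsupp.sub_apply, sub_eq_zero]
      by_cases hr : r S.1 = 0
      · have hgS : S = g ⟨S.1, hS, hr⟩ := rfl
        rw [hgS, Finsupp.lmapDomain_apply, Finsupp.mapDomain_apply hg]
        rfl
      · rw [Finsupp.lmapDomain_apply, Finsupp.mapDomain_of_notMem_range]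
        · exact (Finsupp.mem_supported' _ _).1 hu S fun h => hr (Nat.le_zero.1 (h hS))
        · rintro ⟨T, rfl⟩
          exact hr T.2.2
    · simp only [hc, Submodule.subtype_apply, Submodule.coe_sub, LinearMap.codRestrict_apply]
      abel

end IsToggleRank

section Graphs

variable {k : ℕ}

lemma graphOf_adj {S : Finset (Edge k)} {x y : Fin k} :
    (graphOf k S).Adj x y ↔ ∃ p ∈ S, s(x, y) = s(p.1.1, p.1.2) := by
  rw [graphOf, SimpleGraph.fromEdgeSet_adj]
  refine ⟨fun h => h.1, fun h => ⟨h, ?_⟩⟩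
  obtain ⟨p, -, hp⟩ := h
  rintro rfl
  have := p.2
  rcases Sym2.eq_iff.1 hp with ⟨h1, h2⟩ | ⟨h1, h2⟩ <;> simp [← h1, ← h2] at this

lemma graphOf_adj_of_mem {S : Finset (Edge k)} {p : Edge k} (hp : p ∈ S) :
    (graphOf k S).Adj p.1.1 p.1.2 :=
  graphOf_adj.2 ⟨p, hp, rfl⟩

lemma IsConn.of_reachable {S T : Finset (Edge k)} (hS : IsConn k S)
    (h : ∀ p ∈ S, (graphOf k T).Reachable p.1.1 p.1.2) : IsConn k T := by
  have : Nonempty (Fin k) := hS.nonempty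
  refine ⟨fun x y => ?_⟩
  obtain ⟨w⟩ := hS.preconnected x y
  induction w with
  | nil => exact .refl _
  | cons hadj _ ih =>
    refine .trans ?_ ih
    obtain ⟨p, hp, he⟩ := graphOf_adj.1 hadj
    rcases Sym2.eq_iff.1 he with ⟨rfl, rfl⟩ | ⟨rfl, rfl⟩
    · exact h p hp
    · exact (h p hp).symm

lemma IsConn.mono {S T : Finset (Edge k)} (h : S ⊆ T) (hS : IsConn k S) : IsConn k T :=
  hS.of_reachable fun _ hp => (graphOf_adj_of_mem (h hp)).reachable

lemma IsConn.le_card_add_one {S : Finset (Edge k)} (hS : IsConn k S) : k ≤ S.card + 1 := by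
  classical
  have h1 := SimpleGraph.Connected.card_vert_le_card_edgeSet_add_one hS
  have h2 : (graphOf k S).edgeSet ⊆ (S.image fun p => s(p.1.1, p.1.2) : Finset (Sym2 (Fin k))) := by
    intro q
    induction q with
    | _ x y =>
      intro hq
      obtain ⟨p, hp, he⟩ := graphOf_adj.1 hq
      simp only [Finset.coe_image, Set.mem_image]
      exact ⟨p, hp, he.symm⟩
  have h3 := Nat.card_mono (Finset.finite_toSet _) h2
  have h4 : (S.image fun p => s(p.1.1, p.1.2)).card ≤ S.card := Finset.card_image_le
  simp at h1 h3
  omega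

/-- The ends of `e` have a common neighbour in `S` that is larger than both. -/
def ClosesUp (S : Finset (Edge k)) (e : Edge k) : Prop :=
  ∃ p ∈ S, ∃ q ∈ S, p.1.1 = e.1.1 ∧ q.1.1 = e.1.2 ∧ p.1.2 = q.1.2

/-- The position of an edge in the colexicographic order. -/
def colexCode (e : Edge k) : ℕ := k * e.1.2 + e.1.1 + 1

open Classical in
/-- The largest colexicographic position of an edge whose ends have a larger common neighbour,
or zero if there is no such edge. -/
def colexRank (S : Finset (Edge k)) : ℕ := (Finset.univ.filter (ClosesUp S)).sup colexCode

lemma colexCode_lt_of_lt {e e' : Edge k} (h : e.1.2 < e'.1.2) : colexCode e < colexCode e' := by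
  have h1 : k * (e.1.2 + 1 : ℕ) ≤ k * e'.1.2 := Nat.mul_le_mul_left k h
  have := e.1.1.2
  rw [colexCode, colexCode]
  rw [mul_add] at h1
  omega

lemma colexCode_injective : Function.Injective (colexCode (k := k)) := by
  intro e e' h
  have h2 : e.1.2 = e'.1.2 := by
    rcases lt_trichotomy e.1.2 e'.1.2 with h' | h' | h'
    · exact absurd h (colexCode_lt_of_lt h').ne
    · exact h'
    · exact absurd h (colexCode_lt_of_lt h').ne'
  have h1 : e.1.1 = e'.1.1 := by
    rw [colexCode, colexCode, h2] at h
    exact Fin.ext (by omega)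
  exact Subtype.ext (Prod.ext h1 h2)

lemma ClosesUp.mono {S T : Finset (Edge k)} (h : S ⊆ T) {e : Edge k} :
    ClosesUp S e → ClosesUp T e := by
  rintro ⟨p, hp, q, hq, H⟩
  exact ⟨p, h hp, q, h hq, H⟩

lemma ClosesUp.colexCode_le {S : Finset (Edge k)} {e : Edge k} (h : ClosesUp S e) :
    colexCode e ≤ colexRank S :=
  Finset.le_sup (f := colexCode) (by simpa using h)

lemma colexRank_le_iff {S : Finset (Edge k)} {n : ℕ} :
    colexRank S ≤ n ↔ ∀ e, ClosesUp S e → colexCode e ≤ n := by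
  simp [colexRank]

lemma exists_colexCode_eq {S : Finset (Edge k)} {n : ℕ} (h : colexRank S = n + 1) :
    ∃ e, ClosesUp S e ∧ colexCode e = n + 1 := by
  classical
  have hne : (Finset.univ.filter (ClosesUp S)).Nonempty := by
    by_contra hempty
    rw [Finset.not_nonempty_iff_eq_empty] at hempty
    rw [colexRank, hempty] at h
    simp at h
  obtain ⟨e, he, heq⟩ := Finset.exists_mem_eq_sup _ hne colexCode
  exact ⟨e, (Finset.mem_filter.1 he).2, heq.symm.trans h⟩

lemma ClosesUp.transfer {S T : Finset (Edge k)} {e e' : Edge k}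
    (hST : ∀ p ∈ S, p ≠ e → p ∈ T) (hle : e.1.2 ≤ e'.1.2) (h : ClosesUp S e') :
    ClosesUp T e' := by
  obtain ⟨p, hp, q, hq, h1, h2, h3⟩ := h
  have hlt : e.1.2 < q.1.2 := hle.trans_lt (h2 ▸ q.2)
  refine ⟨p, hST p hp ?_, q, hST q hq ?_, h1, h2, h3⟩
  · rintro rfl
    exact hlt.ne h3
  · rintro rfl
    exact hlt.ne rfl

/-- Toggling the edge that realises the rank does not change the rank. -/
lemma colexRank_eq_of_toggle {S T : Finset (Edge k)} {e : Edge k} (he : ClosesUp S e)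
    (hr : colexRank S = colexCode e) (hST : ∀ p ∈ S, p ≠ e → p ∈ T)
    (hTS : ∀ p ∈ T, p ≠ e → p ∈ S) : colexRank T = colexCode e := by
  refine le_antisymm (colexRank_le_iff.2 fun e' he' => ?_) (he.transfer hST le_rfl).colexCode_le
  rcases lt_or_ge e'.1.2 e.1.2 with h | h
  · exact (colexCode_lt_of_lt h).le
  · exact hr ▸ (he'.transfer hTS h).colexCode_le

lemma IsConn.erase_of_closesUp {S : Finset (Edge k)} (hS : IsConn k S) {e : Edge k}
    (he : ClosesUp S e) : IsConn k (S.erase e) := by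
  obtain ⟨p, hp, q, hq, h1, h2, h3⟩ :=
    he.transfer (T := S.erase e) (fun p hp hne => Finset.mem_erase.2 ⟨hne, hp⟩) le_rfl
  refine hS.of_reachable fun t ht => ?_
  by_cases hte : t = e
  · rw [hte, ← h1, ← h2]
    refine (graphOf_adj_of_mem hp).reachable.trans ?_
    rw [h3]
    exact (graphOf_adj_of_mem hq).reachable.symm
  · exact (graphOf_adj_of_mem (Finset.mem_erase.2 ⟨hte, ht⟩)).reachable

lemma isToggleRank_colexRank (hk : 2 ≤ k) : IsToggleRank (IsConn k) colexRank where
  good_mono _ _ h := IsConn.mono h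
  rank_mono _ _ h := colexRank_le_iff.2 fun _ he => (he.mono h).colexCode_le
  toggle n := by
    by_cases hn : ∃ e : Edge k, colexCode e = n + 1
    · obtain ⟨e, he⟩ := hn
      refine ⟨e, fun S hS hr => ?_⟩
      obtain ⟨e', hS', he'⟩ := exists_colexCode_eq hr
      obtain rfl : e' = e := colexCode_injective (he'.trans he.symm)
      have hr' := hr.trans he.symm
      refine ⟨⟨hS.mono (Finset.subset_insert _ _), ?_⟩, hS.erase_of_closesUp hS', ?_⟩
      · rw [← he]
        exact colexRank_eq_of_toggle hS' hr' (fun p hp _ => Finset.mem_insert_of_mem hp)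
          fun p hp hne => (Finset.mem_insert.1 hp).resolve_left hne
      · rw [← he]
        exact colexRank_eq_of_toggle hS' hr' (fun p hp hne => Finset.mem_erase.2 ⟨hne, hp⟩)
          fun p hp _ => Finset.mem_of_mem_erase hp
    · refine ⟨⟨(⟨0, by omega⟩, ⟨1, by omega⟩), Fin.mk_lt_mk.2 Nat.zero_lt_one⟩,
        fun S _ hr => absurd ?_ hn⟩
      obtain ⟨e, -, he⟩ := exists_colexCode_eq hr
      exact ⟨e, he⟩

lemma colexRank_eq_zero_iff {S : Finset (Edge k)} :
    colexRank S = 0 ↔ Set.InjOn (fun p : Edge k => p.1.2) S := by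
  rw [← Nat.le_zero, colexRank_le_iff]
  refine ⟨fun h p hp q hq hpq => ?_, fun h e he => ?_⟩
  · have hlt : ∀ p ∈ S, ∀ q ∈ S, p.1.2 = q.1.2 → ¬ p.1.1 < q.1.1 := fun p hp q hq hpq hpq' => by
      have := h ⟨(p.1.1, q.1.1), hpq'⟩ ⟨p, hp, q, hq, rfl, rfl, hpq⟩
      simp [colexCode] at this
    exact Subtype.ext (Prod.ext (le_antisymm (not_lt.1 (hlt q hq p hp hpq.symm))
      (not_lt.1 (hlt p hp q hq hpq))) hpq)
  · obtain ⟨p, hp, q, hq, h1, h2, h3⟩ := he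
    have h4 := e.2
    rw [← h1, ← h2, h hp hq h3] at h4
    exact absurd h4 (lt_irrefl _)

lemma image_snd_subset {m : ℕ} (S : Finset (Edge (m + 1))) :
    S.image (fun p => p.1.2) ⊆ Finset.univ.erase 0 := by
  intro c hc
  obtain ⟨p, -, rfl⟩ := Finset.mem_image.1 hc
  simpa using (Fin.zero_le p.1.1).trans_lt p.2 |>.ne'

lemma card_le_of_colexRank_eq_zero {m : ℕ} {S : Finset (Edge (m + 1))} (h : colexRank S = 0) :
    S.card ≤ m := by
  rw [← Finset.card_image_of_injOn (colexRank_eq_zero_iff.1 h)]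
  refine (Finset.card_le_card (image_snd_subset S)).trans ?_
  simp

/-- The graph joining each node `c + 1` to its parent `f c`. -/
def parentGraph {m : ℕ} (f : (c : Fin m) → Fin (c + 1)) : Finset (Edge (m + 1)) :=
  Finset.univ.image fun c : Fin m =>
    ⟨((f c).castLE (by omega), c.succ), by
      simpa [Fin.lt_def, Nat.lt_succ_iff] using (f c).2⟩

lemma mem_parentGraph {m : ℕ} {f : (c : Fin m) → Fin (c + 1)} {p : Edge (m + 1)} :
    p ∈ parentGraph f ↔ ∃ c, (f c : ℕ) = p.1.1 ∧ c.succ = p.1.2 := by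
  simp [parentGraph, Subtype.ext_iff, Prod.ext_iff, Fin.ext_iff]

lemma colexRank_parentGraph {m : ℕ} (f : (c : Fin m) → Fin (c + 1)) :
    colexRank (parentGraph f) = 0 := by
  rw [colexRank_eq_zero_iff]
  intro p hp q hq hpq
  obtain ⟨c, h1, h2⟩ := mem_parentGraph.1 hp
  obtain ⟨d, h3, h4⟩ := mem_parentGraph.1 hq
  obtain rfl : c = d := Fin.succ_injective _ (h2.trans (hpq.trans h4.symm))
  exact Subtype.ext (Prod.ext (Fin.ext (h1.symm.trans h3)) hpq)

lemma isConn_parentGraph {m : ℕ} (f : (c : Fin m) → Fin (c + 1)) :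
    IsConn (m + 1) (parentGraph f) := by
  have h : ∀ n (hn : n < m + 1), (graphOf (m + 1) (parentGraph f)).Reachable ⟨n, hn⟩ 0 := by
    intro n
    induction n using Nat.strong_induction_on with
    | _ n ih =>
      intro hn
      cases n with
      | zero => exact .refl _
      | succ n =>
        have hlt := (f ⟨n, by omega⟩).2
        refine .trans ?_ (ih (f ⟨n, by omega⟩) hlt (by simp at hlt; omega))
        refine (SimpleGraph.Adj.reachable (graphOf_adj.2 ?_)).symm
        exact ⟨⟨(_, _), Fin.mk_lt_mk.2 hlt⟩, mem_parentGraph.2 ⟨⟨n, by omega⟩, rfl, rfl⟩, rfl⟩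
  exact ⟨fun x y => (h x x.2).trans (h y y.2).symm⟩

lemma parentGraph_injective {m : ℕ} : Function.Injective (parentGraph (m := m)) := by
  intro f g h
  funext c
  have hc : ∃ p ∈ parentGraph f, (f c : ℕ) = p.1.1 ∧ c.succ = p.1.2 :=
    ⟨_, Finset.mem_image_of_mem _ (Finset.mem_univ c), rfl, rfl⟩
  obtain ⟨p, hp, h1, h2⟩ := hc
  obtain ⟨d, h3, h4⟩ := mem_parentGraph.1 (h ▸ hp)
  obtain rfl : d = c := Fin.succ_injective _ (h4.trans h2.symm)
  exact Fin.ext (h1.trans h3.symm)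

lemma exists_parentGraph_eq {m : ℕ} {S : Finset (Edge (m + 1))} (hS : IsConn (m + 1) S)
    (hr : colexRank S = 0) : ∃ f, parentGraph f = S := by
  have hinj := colexRank_eq_zero_iff.1 hr
  have himage : S.image (fun p => p.1.2) = Finset.univ.erase 0 := by
    refine Finset.eq_of_subset_of_card_le (image_snd_subset S) ?_
    rw [Finset.card_image_of_injOn hinj]
    have := hS.le_card_add_one
    simpa using this
  have hparent : ∀ c : Fin m, ∃ a : Fin (c + 1), ∃ p ∈ S, (a : ℕ) = p.1.1 ∧ c.succ = p.1.2 := by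
    intro c
    have hc : c.succ ∈ S.image (fun p => p.1.2) := by simp [himage]
    obtain ⟨p, hp, hpc⟩ := Finset.mem_image.1 hc
    have hlt := p.2
    rw [hpc, Fin.lt_def] at hlt
    exact ⟨⟨p.1.1, hlt⟩, p, hp, rfl, hpc.symm⟩
  choose f hf using hparent
  refine ⟨f, Finset.eq_of_subset_of_card_le (fun p hp => ?_) ?_⟩
  · obtain ⟨c, h1, h2⟩ := mem_parentGraph.1 hp
    obtain ⟨q, hq, h3, h4⟩ := hf c
    have : p = q := Subtype.ext (Prod.ext (Fin.ext (h1.symm.trans h3)) (h2.symm.trans h4))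
    exact this ▸ hq
  · have h1 := card_le_of_colexRank_eq_zero hr
    have h2 := (isConn_parentGraph f).le_card_add_one
    omega

/-- The critical connected graphs are counted by their parent functions. -/
lemma card_critical (m : ℕ) :
    Nat.card {S : Finset (Edge (m + 1)) // IsConn (m + 1) S ∧ colexRank S = 0} =
      Nat.factorial m := by
  let F : ((c : Fin m) → Fin (c + 1)) →
      {S : Finset (Edge (m + 1)) // IsConn (m + 1) S ∧ colexRank S = 0} :=
    fun f => ⟨parentGraph f, isConn_parentGraph f, colexRank_parentGraph f⟩
  have hF : Function.Bijective F := by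
    refine ⟨fun f g h => parentGraph_injective (congrArg Subtype.val h), fun S => ?_⟩
    obtain ⟨f, hf⟩ := exists_parentGraph_eq S.2.1 S.2.2
    exact ⟨f, Subtype.ext hf⟩
  rw [← Nat.card_eq_of_bijective F hF, Nat.card_pi]
  simp only [Nat.card_eq_fintype_card, Fintype.card_fin]
  rw [Fin.prod_univ_eq_prod_range (fun i => i + 1) m, Finset.prod_range_add_one_eq_factorial]

end Graphs

/-- For every `k ≥ 2`, the homology of the complex `Δ¹(k)` of
connected graphs vanishes in every degree `i ≠ k − 2`, and `H_{k−2}(Δ¹(k))` is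
free abelian of rank `(k−1)!`. -/
theorem homology_connected_graph_complex (k : ℕ) (hk : 2 ≤ k) :
    (∀ i : ℕ, i ≠ k - 2 → Subsingleton (homology (Edge k) (IsConn k) i)) ∧
    Nonempty (homology (Edge k) (IsConn k) (k - 2) ≃ₗ[ℤ]
      (Fin (Nat.factorial (k - 1)) → ℤ)) := by
  obtain ⟨m, rfl⟩ : ∃ m, k = m + 1 := ⟨k - 1, by omega⟩
  have H := isToggleRank_colexRank hk
  have hcard : ∀ S, IsConn (m + 1) S → m + 1 - 2 + 1 ≤ S.card := fun S hS => by
    have := hS.le_card_add_one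
    omega
  have hcrit : ∀ S, IsConn (m + 1) S → colexRank S = 0 → S.card = m + 1 - 2 + 1 :=
    fun S hS hr => by
      have h1 := hS.le_card_add_one
      have h2 := card_le_of_colexRank_eq_zero hr
      omega
  have h0 : ¬ IsConn (m + 1) ∅ := fun h => by simpa using hcard ∅ h
  refine ⟨fun i hi => H.subsingleton_homology h0 hcrit hi, ?_⟩
  obtain ⟨φ⟩ := H.nonempty_homology_equiv h0 hcrit hcard
  exact ⟨φ.trans ((Finsupp.linearEquivFunOnFinite ℤ ℤ _).trans
    (LinearEquiv.funCongrLeft ℤ ℤ (Finite.equivFinOfCardEq (card_critical m)).symm))⟩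

end
end

section
/- For every integer k ≥ 2, the homology of the complex of two-connected graphs Δ²(k) vanishes in every degree i ≠ 2k−4, and H_{2k−4}(Δ²(k)) is a free abelian group of rank (k−2)!. -/
set_option autoImplicit false

/-!
Statement 2: For every integer k ≥ 2, the homology of the complex of
two-connected graphs Δ²(k) vanishes in every degree i ≠ 2k−4, and
H_{2k−4}(Δ²(k)) is a free abelian group of rank (k−2)!.
-/

noncomputable section

open Finset

/-- A set of edges is good for `Δ²(k)` iff the corresponding graph on all `k`
nodes is 2-connected: it is connected and, for each node `v`, removing `v`
together with all incident edges leaves a connected graph on the remaining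
`k − 1` nodes. -/
def IsTwoConn (k : ℕ) (S : Finset (Edge k)) : Prop :=
  (graphOf k S).Connected ∧
    ∀ v : Fin k, ((graphOf k S).induce {u | u ≠ v}).Connected

section FamilyComplex

variable {V : Type} {F A : Set (Finset V)} {x : Finset V → ℤ}

/-- The chains supported on the family `F`. -/
def familyChains (F : Set (Finset V)) : Submodule ℤ (Finset V → ℤ) where
  carrier := {x | ∀ S ∉ F, x S = 0}
  add_mem' hx hy S hS := by simp [hx S hS, hy S hS]
  zero_mem' _ _ := rfl
  smul_mem' c x hx S hS := by simp [hx S hS]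

lemma indicator_mem_familyChains (x : Finset V → ℤ) : F.indicator x ∈ familyChains F :=
  fun _ hS => Set.indicator_of_notMem hS _

lemma familyChains_mono (h : A ⊆ F) : familyChains A ≤ familyChains F :=
  fun _ hx S hS => hx S fun hA => hS (h hA)

lemma mem_familyChains_of_indicator (hx : x ∈ familyChains F)
    (h : (F \ A).indicator x = 0) : x ∈ familyChains A := by
  intro S hS
  by_cases hF : S ∈ F
  · have := congrFun h S
    rwa [Set.indicator_of_mem (show S ∈ F \ A from ⟨hF, hS⟩)] at this
  · exact hx S hF

/-- The part of a chain supported on the `n`-element sets. -/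
def sizePart (n : ℕ) (x : Finset V → ℤ) : Finset V → ℤ := {S : Finset V | S.card = n}.indicator x

lemma sizePart_apply (n : ℕ) (x : Finset V → ℤ) (S : Finset V) :
    sizePart n x S = if S.card = n then x S else 0 := by
  simp [sizePart, Set.indicator_apply]

lemma sizePart_mem {n : ℕ} (hx : x ∈ familyChains F) : sizePart n x ∈ familyChains F := by
  intro S hS
  rw [sizePart_apply, hx S hS, ite_self]

variable [LinearOrder V]

/-- The sign with which `s` is removed from `insert s T`. -/
def removalSign (T : Finset V) (s : V) : ℤ := (-1) ^ (T.filter fun t => t < s).card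

lemma removalSign_mul_self (T : Finset V) (s : V) : removalSign T s * removalSign T s = 1 := by
  rw [removalSign, ← mul_pow]; norm_num

lemma removalSign_insert_of_lt {T : Finset V} {s t : V} (ht : t ∉ T) (h : t < s) :
    removalSign (insert t T) s = -removalSign T s := by
  rw [removalSign, removalSign, filter_insert, if_pos h, card_insert_of_notMem (by simp [ht]),
    pow_succ]
  ring

lemma removalSign_insert_of_gt {T : Finset V} {s t : V} (h : s < t) :
    removalSign (insert t T) s = removalSign T s := by
  rw [removalSign, removalSign, filter_insert, if_neg (not_lt.mpr h.le)]

lemma removalSign_anticomm {T : Finset V} {s t : V} (hs : s ∉ T) (ht : t ∉ T) (hst : s ≠ t) :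
    removalSign T s * removalSign (insert s T) t =
      -(removalSign T t * removalSign (insert t T) s) := by
  rcases lt_or_gt_of_ne hst with h | h
  · rw [removalSign_insert_of_lt hs h, removalSign_insert_of_gt h]; ring
  · rw [removalSign_insert_of_lt ht h, removalSign_insert_of_gt h]; ring

variable [Fintype V]

/-- The differential of the complex spanned by a family `F` of finite sets; all degrees are
treated at once. -/
def familyBdry (F : Set (Finset V)) : (Finset V → ℤ) →ₗ[ℤ] (Finset V → ℤ) where
  toFun x := F.indicator fun T => ∑ s ∈ Tᶜ, removalSign T s * x (insert s T)
  map_add' x y := by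
    rw [← Set.indicator_add']
    congr 1; funext T
    simp [mul_add, sum_add_distrib]
  map_smul' c x := by
    funext T
    by_cases hT : T ∈ F
    · simp only [Set.indicator_of_mem hT, Pi.smul_apply, smul_eq_mul, mul_sum, RingHom.id_apply]
      exact sum_congr rfl fun s _ => by ring
    · simp [Set.indicator_of_notMem hT]


lemma familyBdry_apply {T : Finset V} (hT : T ∈ F) :
    familyBdry F x T = ∑ s ∈ Tᶜ, removalSign T s * x (insert s T) :=
  Set.indicator_of_mem hT fun T => ∑ s ∈ Tᶜ, removalSign T s * x (insert s T)

lemma familyBdry_apply_notMem {T : Finset V} (hT : T ∉ F) : familyBdry F x T = 0 :=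
  Set.indicator_of_notMem hT fun T => ∑ s ∈ Tᶜ, removalSign T s * x (insert s T)

lemma familyBdry_mem (x : Finset V → ℤ) : familyBdry F x ∈ familyChains F :=
  fun _ hS => familyBdry_apply_notMem hS

lemma familyBdry_univ_comp (x : Finset V → ℤ) :
    familyBdry Set.univ (familyBdry Set.univ x) = 0 := by
  funext T
  simp only [familyBdry_apply (Set.mem_univ _), Pi.zero_apply]
  have hsum : ∀ f : V → V → ℤ, ∑ s ∈ Tᶜ, removalSign T s * ∑ t ∈ (insert s T)ᶜ, f s t =
      ∑ s, ∑ t, if s ∉ T ∧ t ∉ T ∧ s ≠ t then removalSign T s * f s t else 0 := by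
    intro f
    rw [← sum_subset (subset_univ Tᶜ)]
    · refine sum_congr rfl fun s hs => ?_
      rw [mul_sum, ← sum_subset (subset_univ (insert s T)ᶜ)]
      · refine sum_congr rfl fun t ht => ?_
        simp only [mem_compl, mem_insert, not_or] at hs ht
        rw [if_pos ⟨hs, ht.2, Ne.symm ht.1⟩]
      · intro t _ ht
        refine if_neg fun h => ht ?_
        simp [h.2.1, Ne.symm h.2.2]
    · intro s _ hs
      exact sum_eq_zero fun t _ => if_neg fun h => hs (by simpa using h.1)
  rw [hsum]
  refine self_eq_neg.mp ?_
  conv_lhs => rw [sum_comm]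
  rw [← sum_neg_distrib]
  refine sum_congr rfl fun s _ => ?_
  rw [← sum_neg_distrib]
  refine sum_congr rfl fun t _ => ?_
  by_cases h : s ∉ T ∧ t ∉ T ∧ s ≠ t
  · rw [if_pos h, if_pos ⟨h.2.1, h.1, h.2.2.symm⟩, ← mul_assoc, ← mul_assoc,
      removalSign_anticomm h.1 h.2.1 h.2.2, insert_comm]
    ring
  · rw [if_neg h, if_neg fun h' => h ⟨h'.2.1, h'.1, h'.2.2.symm⟩, neg_zero]

lemma familyBdry_comp (hF : F.OrdConnected) (hx : x ∈ familyChains F) :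
    familyBdry F (familyBdry F x) = 0 := by
  funext T
  by_cases hT : T ∈ F
  · have := congrFun (familyBdry_univ_comp x) T
    rw [familyBdry_apply (Set.mem_univ _)] at this
    rw [familyBdry_apply hT, ← this]
    refine sum_congr rfl fun s _ => ?_
    congr 1
    by_cases hs : insert s T ∈ F
    · rw [familyBdry_apply hs, familyBdry_apply (Set.mem_univ _)]
    · rw [familyBdry_apply_notMem hs, familyBdry_apply (Set.mem_univ _)]
      refine (sum_eq_zero fun t _ => ?_).symm
      rw [hx, mul_zero]
      exact fun h => hs (hF.out hT h ⟨subset_insert _ _, subset_insert _ _⟩)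
  · exact familyBdry_apply_notMem hT

/-- If `A` is closed under passing to subsets in `F`, its complex is a subcomplex. -/
lemma familyBdry_eq_of_lower (hAF : A ⊆ F) (hA : ∀ S ∈ A, ∀ T ∈ F, T ⊆ S → T ∈ A)
    (hx : x ∈ familyChains A) : familyBdry F x = familyBdry A x := by
  funext T
  by_cases hT : T ∈ A
  · rw [familyBdry_apply hT, familyBdry_apply (hAF hT)]
  · rw [familyBdry_apply_notMem hT]
    by_cases hTF : T ∈ F
    · rw [familyBdry_apply hTF]
      refine sum_eq_zero fun s _ => ?_
      rw [hx, mul_zero]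
      exact fun h => hT (hA _ h T hTF (subset_insert _ _))
    · exact familyBdry_apply_notMem hTF

/-- If `A` is closed under passing to subsets in `F`, the complex of `F \ A` is a quotient. -/
lemma indicator_familyBdry (hA : ∀ S ∈ A, ∀ T ∈ F, T ⊆ S → T ∈ A) (hx : x ∈ familyChains F) :
    (F \ A).indicator (familyBdry F x) = familyBdry (F \ A) ((F \ A).indicator x) := by
  funext T
  by_cases hT : T ∈ F \ A
  · rw [Set.indicator_of_mem hT, familyBdry_apply hT, familyBdry_apply hT.1]
    refine sum_congr rfl fun s _ => ?_
    congr 1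
    by_cases hs : insert s T ∈ F \ A
    · rw [Set.indicator_of_mem hs]
    · rw [Set.indicator_of_notMem hs]
      exact hx _ fun h => hs ⟨h, fun h' => hT.2 (hA _ h' T hT.1 (subset_insert _ _))⟩
  · rw [Set.indicator_of_notMem hT, familyBdry_apply_notMem hT]

lemma familyBdry_sizePart (n : ℕ) (x : Finset V → ℤ) (T : Finset V) :
    familyBdry F (sizePart n x) T = if T.card + 1 = n then familyBdry F x T else 0 := by
  by_cases hT : T ∈ F
  · rw [familyBdry_apply hT, familyBdry_apply hT]
    have : ∀ s ∈ Tᶜ, removalSign T s * sizePart n x (insert s T) =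
        if T.card + 1 = n then removalSign T s * x (insert s T) else 0 := by
      intro s hs
      rw [sizePart_apply, card_insert_of_notMem (by simpa using hs)]
      split_ifs <;> simp
    rw [sum_congr rfl this]
    split_ifs <;> simp
  · simp [familyBdry_apply_notMem hT]

/-- The homology of the complex of the family `F` is concentrated on the sets of size `n`, where
it is free of rank `r`: the classes of the cycles `z i` form a basis. -/
def HomologyFreeAt (F : Set (Finset V)) (n r : ℕ) : Prop :=
  ∃ (ι : Type) (_ : Fintype ι) (z : ι → Finset V → ℤ), Fintype.card ι = r ∧
    (∀ i, z i ∈ familyChains F) ∧ (∀ i, sizePart n (z i) = z i) ∧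
    (∀ i, familyBdry F (z i) = 0) ∧
    (∀ c ∈ familyChains F, familyBdry F c = 0 →
      ∃ l : ι → ℤ, ∃ w ∈ familyChains F, c = ∑ i, l i • z i + familyBdry F w) ∧
    (∀ l : ι → ℤ, ∀ w ∈ familyChains F, ∑ i, l i • z i = familyBdry F w → l = 0)

lemma homologyFreeAt_union {n r s : ℕ} (hF : F.OrdConnected) (hAF : A ⊆ F)
    (hA : ∀ S ∈ A, ∀ T ∈ F, T ⊆ S → T ∈ A) (h₁ : HomologyFreeAt A n r)
    (h₂ : HomologyFreeAt (F \ A) n s) : HomologyFreeAt F n (r + s) := by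
  obtain ⟨ι, _, y, hr, hyA, hyn, hy, hyspan, hyind⟩ := h₁
  obtain ⟨κ, _, z, hs, hzB, hzn, hz, hzspan, hzind⟩ := h₂
  have hBF : F \ A ⊆ F := Set.sdiff_subset
  have indic : ∀ {x}, x ∈ familyChains (F \ A) → (F \ A).indicator x = x := fun hx =>
    Set.indicator_eq_self.mpr fun S hS => by_contra fun h => hS (hx S h)
  have indicA : ∀ {x}, x ∈ familyChains A → (F \ A).indicator x = 0 := by
    intro x hx
    funext S
    by_cases hS : S ∈ F \ A
    · rw [Set.indicator_of_mem hS, hx S hS.2]; rfl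
    · rw [Set.indicator_of_notMem hS]; rfl
  have lift : ∀ j, ∃ w ∈ familyChains A, sizePart n w = w ∧
      familyBdry F (z j) = familyBdry F w := by
    intro j
    have hzF := familyChains_mono hBF (hzB j)
    have hu : familyBdry F (z j) ∈ familyChains A := by
      refine mem_familyChains_of_indicator (familyBdry_mem _) ?_
      rw [indicator_familyBdry hA hzF, indic (hzB j), hz]
    obtain ⟨l, w, hw, hlw⟩ := hyspan _ hu (by
      rw [← familyBdry_eq_of_lower hAF hA hu, familyBdry_comp hF hzF])
    refine ⟨sizePart n w, sizePart_mem hw, ?_, ?_⟩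
    · funext S; simp only [sizePart_apply]; split_ifs <;> rfl
    · rw [familyBdry_eq_of_lower hAF hA (sizePart_mem hw)]
      funext T
      rw [familyBdry_sizePart]
      split_ifs with h
      · rw [hlw]
        simp only [Pi.add_apply, Finset.sum_apply, Pi.smul_apply]
        rw [sum_eq_zero, zero_add]
        intro i _
        rw [← hyn i, sizePart_apply, if_neg (by omega), smul_zero]
      · rw [← hzn j, familyBdry_sizePart, if_neg h]
  choose w hwA hwn hw using lift
  have hmem : ∀ j, z j - w j ∈ familyChains F := fun j =>
    Submodule.sub_mem _ (familyChains_mono hBF (hzB j)) (familyChains_mono hAF (hwA j))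
  have hcyc : ∀ j, familyBdry F (z j - w j) = 0 := fun j => by rw [map_sub, hw, sub_self]
  have hsumB : ∀ m : κ → ℤ, (F \ A).indicator (∑ j, m j • (z j - w j)) = ∑ j, m j • z j := by
    intro m
    have : ∑ j, m j • (z j - w j) = ∑ j, m j • z j - ∑ j, m j • w j := by
      rw [← sum_sub_distrib]; exact sum_congr rfl fun j _ => smul_sub _ _ _
    rw [this, Set.indicator_sub', indic (Submodule.sum_smul_mem _ _ fun j _ => hzB j),
      indicA (Submodule.sum_smul_mem _ _ fun j _ => hwA j), sub_zero]
  have hsumF : ∀ m : κ → ℤ, ∑ j, m j • (z j - w j) ∈ familyChains F := fun m =>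
    Submodule.sum_smul_mem _ _ fun j _ => hmem j
  have hsumcyc : ∀ m : κ → ℤ, familyBdry F (∑ j, m j • (z j - w j)) = 0 := by
    intro m
    rw [map_sum]
    exact sum_eq_zero fun j _ => by rw [map_smul, hcyc, smul_zero]
  -- every cycle of `F` is, modulo the lifted cycles and boundaries, a chain on `A`
  have reduce : ∀ c ∈ familyChains F, (F \ A).indicator (familyBdry F c) = 0 →
      ∃ m : κ → ℤ, ∃ v ∈ familyChains F,
        c - ∑ j, m j • (z j - w j) - familyBdry F v ∈ familyChains A := by
    intro c hc hcB
    obtain ⟨m, v, hv, hmv⟩ := hzspan _ (indicator_mem_familyChains c)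
      (by rw [← indicator_familyBdry hA hc, hcB])
    refine ⟨m, v, familyChains_mono hBF hv, mem_familyChains_of_indicator
      (Submodule.sub_mem _ (Submodule.sub_mem _ hc (hsumF m)) (familyBdry_mem v)) ?_⟩
    rw [Set.indicator_sub', Set.indicator_sub', hsumB,
      indicator_familyBdry hA (familyChains_mono hBF hv), indic hv, hmv]
    abel
  refine ⟨ι ⊕ κ, inferInstance, Sum.elim y fun j => z j - w j, by
    rw [Fintype.card_sum, hr, hs], ?_, ?_, ?_, ?_, ?_⟩
  · rintro (i | j)
    · exact familyChains_mono hAF (hyA i)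
    · exact hmem j
  · rintro (i | j)
    · exact hyn i
    · funext S
      have h₁ := congrFun (hzn j) S
      have h₂ := congrFun (hwn j) S
      simp only [sizePart_apply, Sum.elim_inr, Pi.sub_apply] at *
      split_ifs at * <;> omega
  · rintro (i | j)
    · exact (familyBdry_eq_of_lower hAF hA (hyA i)).trans (hy i)
    · exact hcyc j
  · intro c hc hc0
    obtain ⟨m, v, hv, hm⟩ := reduce c hc (by rw [hc0, Set.indicator_zero'])
    obtain ⟨l, u, hu, hlu⟩ := hyspan _ hm (by
      rw [← familyBdry_eq_of_lower hAF hA hm, map_sub, map_sub, hc0, hsumcyc,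
        familyBdry_comp hF hv, sub_zero, sub_zero])
    refine ⟨Sum.elim l m, u + v,
      Submodule.add_mem _ (familyChains_mono hAF hu) hv, ?_⟩
    rw [Fintype.sum_sum_type, map_add, familyBdry_eq_of_lower hAF hA hu]
    simp only [Sum.elim_inl, Sum.elim_inr]
    rw [sub_sub, sub_eq_iff_eq_add] at hlu
    rw [hlu]
    abel
  · intro l v hv hlv
    rw [Fintype.sum_sum_type] at hlv
    simp only [Sum.elim_inl, Sum.elim_inr] at hlv
    have hyF : ∑ i, l (Sum.inl i) • y i ∈ familyChains A :=
      Submodule.sum_smul_mem _ _ fun i _ => hyA i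
    have hκ : (fun j => l (Sum.inr j)) = 0 := by
      refine hzind _ _ (indicator_mem_familyChains v) ?_
      rw [← indicator_familyBdry hA hv, ← hlv, Set.indicator_add', indicA hyF, zero_add]
      exact (hsumB fun j => l (Sum.inr j)).symm
    have hsum0 : ∑ j, l (Sum.inr j) • (z j - w j) = 0 :=
      sum_eq_zero fun j _ => by rw [show l (Sum.inr j) = 0 from congrFun hκ j, zero_smul]
    rw [hsum0, add_zero] at hlv
    obtain ⟨m, u, hu, hm⟩ := reduce v hv (by rw [← hlv, indicA hyF])
    have hι : (fun i => l (Sum.inl i)) = 0 := by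
      refine hyind _ _ hm ?_
      rw [← familyBdry_eq_of_lower hAF hA hm, map_sub, map_sub, hsumcyc,
        familyBdry_comp hF hu, sub_zero, sub_zero, hlv]
    funext i
    rcases i with i | j
    · exact congrFun hι i
    · exact congrFun hκ j

/-- A family closed under adding and removing a fixed element has no homology. -/
lemma homologyFreeAt_of_toggle (e : V) (n : ℕ)
    (h : ∀ S, e ∉ S → (insert e S ∈ F ↔ S ∈ F)) : HomologyFreeAt F n 0 := by
  refine ⟨Empty, inferInstance, Empty.elim, rfl, fun i => i.elim, fun i => i.elim,
    fun i => i.elim, ?_, fun l _ _ _ => funext fun i => i.elim⟩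
  intro c hc hc0
  have hw : ∀ S, e ∈ S → S ∉ F → c (S.erase e) = 0 := fun S he hS =>
    hc _ fun h' => hS (by rwa [← h _ (notMem_erase e S), insert_erase he] at h')
  refine ⟨Empty.elim, fun S => if e ∈ S then removalSign S e * c (S.erase e) else 0, ?_, ?_⟩
  · intro S hS
    by_cases he : e ∈ S
    · simp only [if_pos he, hw S he hS, mul_zero]
    · simp only [if_neg he]
  · rw [Finset.univ_eq_empty, sum_empty, zero_add]
    funext T
    by_cases hT : T ∈ F
    · rw [familyBdry_apply hT]
      by_cases he : e ∈ T
      · obtain ⟨U, hU, rfl⟩ : ∃ U, e ∉ U ∧ T = insert e U :=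
          ⟨T.erase e, notMem_erase e T, (insert_erase he).symm⟩
        have hUF : U ∈ F := (h U hU).mp hT
        have h0 := congrFun hc0 U
        rw [familyBdry_apply hUF, Pi.zero_apply,
          ← add_sum_erase _ _ (show e ∈ Uᶜ by simpa using hU)] at h0
        have hsgn : ∀ U : Finset V, e ∉ U → removalSign (insert e U) e = removalSign U e := by
          intro U hU
          rw [removalSign, removalSign, filter_insert, if_neg (lt_irrefl e)]
        have hcompl : (insert e U)ᶜ = Uᶜ.erase e := by
          ext; simp
        rw [hcompl]
        have key : ∀ s ∈ Uᶜ.erase e, removalSign (insert e U) s *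
            (if e ∈ insert s (insert e U) then
              removalSign (insert s (insert e U)) e * c ((insert s (insert e U)).erase e) else 0) =
            -removalSign U e * (removalSign U s * c (insert s U)) := by
          intro s hs
          rw [mem_erase, mem_compl] at hs
          have hes : e ∉ insert s U := by
            rw [mem_insert]; rintro (h' | h')
            exacts [hs.1 h'.symm, hU h']
          rw [if_pos (by simp), insert_comm, erase_insert hes, hsgn _ hes]
          have := removalSign_anticomm hU hs.2 (Ne.symm hs.1)
          have h1 := removalSign_mul_self U e
          linear_combination
            (removalSign U e * removalSign (insert s U) e * c (insert s U)) * this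
              - removalSign (insert e U) s * removalSign (insert s U) e * c (insert s U) * h1
              - removalSign U e * removalSign U s * c (insert s U) *
                removalSign_mul_self (insert s U) e
        rw [sum_congr rfl key, ← mul_sum]
        linear_combination (removalSign U e) * h0 - c (insert e U) * removalSign_mul_self U e
      · rw [← add_sum_erase _ _ (show e ∈ Tᶜ by simpa using he), sum_eq_zero, add_zero]
        · rw [if_pos (mem_insert_self _ _), erase_insert he, removalSign, removalSign,
            filter_insert, if_neg (lt_irrefl e), ← mul_assoc, ← mul_pow]
          simp
        · intro s hs
          rw [mem_erase] at hs
          rw [if_neg, mul_zero]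
          rw [mem_insert]; rintro (h' | h')
          exacts [hs.1 h'.symm, he h']
    · rw [familyBdry_apply_notMem hT, hc T hT]

lemma homologyFreeAt_singleton (S : Finset V) : HomologyFreeAt {S} S.card 1 := by
  have hzero : ∀ x ∈ familyChains {S}, familyBdry {S} x = 0 := by
    intro x hx
    funext T
    by_cases hT : T = S
    · subst hT
      rw [familyBdry_apply (Set.mem_singleton _)]
      refine sum_eq_zero fun s hs => ?_
      rw [hx, mul_zero]
      simpa using hs
    · exact familyBdry_apply_notMem hT
  have hmem : Pi.single S 1 ∈ familyChains {S} := fun T hT => Pi.single_eq_of_ne hT _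
  refine ⟨Unit, inferInstance, fun _ => Pi.single S 1, rfl, fun _ => hmem, fun _ => ?_,
    fun _ => hzero _ hmem, fun c hc _ => ⟨fun _ => c S, 0, Submodule.zero_mem _, ?_⟩,
    fun l w hw h => ?_⟩
  · funext T
    rw [sizePart_apply]
    split_ifs with h
    · rfl
    · have hTS : T ≠ S := by rintro rfl; exact h rfl
      simp [hTS]
  · funext T
    by_cases hT : T = S
    · subst hT; simp
    · simp [hT, hc T hT]
  · funext i
    have := congrFun h S
    rw [hzero w hw] at this
    simpa using this

end FamilyComplex

section Transfer

variable {V : Type} {good : Finset V → Prop}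

lemma mem_badChains_iff {d : ℕ} (c : Chain V d) :
    c ∈ badChains V good d ↔ ∀ S : Gen V d, good S.1 → c S = 0 := by
  have : badChains V good d = Finsupp.supported ℤ ℤ {S : Gen V d | ¬ good S.1} := by
    rw [Finsupp.supported_eq_span_single, badChains]
    congr 1
    ext x
    simp only [Set.mem_ofPred_eq, Set.mem_image]
    exact exists_congr fun S => and_congr_right fun _ => eq_comm
  rw [this, Finsupp.mem_supported']
  simp

/-- The components of a chain of degree `d` on the good sets, as a function on all sets. -/
def goodPart (good : Finset V → Prop) (d : ℕ) : Chain V d →ₗ[ℤ] (Finset V → ℤ) := by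
  classical
  exact
  { toFun := fun c S => if h : good S ∧ S.card = d + 1 then c ⟨S, h.2⟩ else 0
    map_add' := fun c c' => by
      funext S
      by_cases h : good S ∧ S.card = d + 1 <;> simp [h]
    map_smul' := fun a c => by
      funext S
      by_cases h : good S ∧ S.card = d + 1 <;> simp [h] }

lemma goodPart_apply {d : ℕ} (c : Chain V d) {S : Finset V} (hS : good S)
    (h : S.card = d + 1) : goodPart good d c S = c ⟨S, h⟩ :=
  dif_pos (⟨hS, h⟩ : good S ∧ S.card = d + 1)

lemma goodPart_apply_of_not {d : ℕ} (c : Chain V d) {S : Finset V}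
    (h : ¬ (good S ∧ S.card = d + 1)) : goodPart good d c S = 0 :=
  dif_neg h

lemma goodPart_mem {d : ℕ} (c : Chain V d) : goodPart good d c ∈ familyChains {S | good S} :=
  fun _ hS => goodPart_apply_of_not c fun h => hS h.1

lemma goodPart_eq_zero_iff {d : ℕ} (c : Chain V d) :
    goodPart good d c = 0 ↔ c ∈ badChains V good d := by
  rw [mem_badChains_iff]
  constructor
  · intro h S hS
    rw [← goodPart_apply c hS S.2, h]
    rfl
  · intro h
    funext S
    by_cases hS : good S ∧ S.card = d + 1
    · rw [goodPart_apply c hS.1 hS.2, h _ hS.1]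
      rfl
    · exact goodPart_apply_of_not c hS

variable [Fintype V]

/-- The degree-`d` part of a function on sets, as a chain. -/
def chainOf (d : ℕ) : (Finset V → ℤ) →ₗ[ℤ] Chain V d :=
  (Finsupp.linearEquivFunOnFinite ℤ ℤ (Gen V d)).symm.toLinearMap ∘ₗ
    LinearMap.funLeft ℤ ℤ Subtype.val

lemma chainOf_apply {d : ℕ} (x : Finset V → ℤ) (S : Gen V d) : chainOf d x S = x S.1 := rfl

lemma goodPart_chainOf {d : ℕ} {x : Finset V → ℤ} (hx : x ∈ familyChains {S | good S}) :
    goodPart good d (chainOf d x) = sizePart (d + 1) x := by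
  funext S
  rw [sizePart_apply]
  by_cases hS : good S
  · split_ifs with h
    · rw [goodPart_apply _ hS h, chainOf_apply]
    · exact goodPart_apply_of_not _ fun h' => h h'.2
  · rw [goodPart_apply_of_not _ fun h => hS h.1, hx S hS, ite_self]

variable [LinearOrder V]

lemma bdry_apply {d : ℕ} (c : Chain V (d + 1)) (T : Gen V d) :
    bdry V (d + 1) c T =
      ∑ s ∈ T.1ᶜ, removalSign T.1 s *
        (if h : (insert s T.1).card = d + 1 + 1 then c ⟨insert s T.1, h⟩ else 0) := by
  induction c using Finsupp.induction_linear with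
  | zero => simp
  | add f g hf hg =>
    rw [map_add, Finsupp.add_apply, hf, hg, ← sum_add_distrib]
    refine sum_congr rfl fun s _ => ?_
    split_ifs <;> simp [mul_add]
  | single S a =>
    rw [bdry, Finsupp.lift_apply, Finsupp.sum_single_index (by simp), Finsupp.smul_apply,
      Finsupp.finsetSum_apply, smul_eq_mul, mul_sum]
    have hleft : ∀ s ∈ S.1, a * (((-1 : ℤ) ^ (S.1.filter fun t => t < s).card) •
        (if h : (S.1.erase s).card = d + 1 - 1 + 1 then
          Finsupp.single (⟨S.1.erase s, h⟩ : Gen V (d + 1 - 1)) (1 : ℤ) else 0)) T =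
        if S.1.erase s = T.1 then removalSign T.1 s * a else 0 := by
      intro s hs
      have hcard : (S.1.erase s).card = d + 1 - 1 + 1 := by rw [card_erase_of_mem hs, S.2]; rfl
      rw [dif_pos hcard, Finsupp.smul_apply, Finsupp.single_apply]
      by_cases hT : S.1.erase s = T.1
      · rw [if_pos (Subtype.ext hT), if_pos hT, ← hT, removalSign, filter_erase,
          erase_eq_of_notMem (by simp)]
        simp [mul_comm]
      · rw [if_neg fun h => hT (congrArg Subtype.val h), if_neg hT]
        simp
    have hright : ∀ s ∈ T.1ᶜ, (removalSign T.1 s * if h : (insert s T.1).card = d + 1 + 1 then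
        Finsupp.single S a ⟨insert s T.1, h⟩ else 0) =
        if insert s T.1 = S.1 then removalSign T.1 s * a else 0 := by
      intro s hs
      rw [dif_pos (by rw [card_insert_of_notMem (by simpa using hs), T.2]), Finsupp.single_apply]
      by_cases hS : insert s T.1 = S.1
      · rw [if_pos (Subtype.ext hS.symm), if_pos hS]
      · rw [if_neg fun h => hS (congrArg Subtype.val h).symm, if_neg hS, mul_zero]
    rw [sum_congr rfl hleft, sum_congr rfl hright, ← sum_filter, ← sum_filter]
    refine sum_congr (Finset.ext fun s => ?_) fun _ _ => rfl
    simp only [mem_filter, mem_compl]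
    constructor
    · rintro ⟨hs, h⟩
      exact ⟨h ▸ notMem_erase s S.1, h ▸ insert_erase hs⟩
    · rintro ⟨hs, h⟩
      exact ⟨h ▸ mem_insert_self s T.1, h ▸ erase_insert hs⟩

lemma goodPart_bdry (hup : ∀ S T, S ⊆ T → good S → good T) (hne : ¬ good ∅) {d : ℕ}
    (c : Chain V d) : goodPart good (d - 1) (bdry V d c) =
      familyBdry {S | good S} (goodPart good d c) := by
  funext T
  by_cases hT : good T
  · rw [familyBdry_apply (F := {S | good S}) hT]
    have hpos : 0 < T.card := card_pos.mpr (nonempty_iff_ne_empty.mpr fun h => hne (h ▸ hT))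
    by_cases hc : T.card = d
    · obtain ⟨d, rfl⟩ : ∃ m, d = m + 1 := ⟨d - 1, by omega⟩
      rw [goodPart_apply _ hT (show T.card = d + 1 - 1 + 1 from hc)]
      refine (bdry_apply c ⟨T, hc⟩).trans (sum_congr rfl fun s hs => ?_)
      have hcard : (insert s T).card = d + 1 + 1 := by
        rw [card_insert_of_notMem (by simpa using hs), hc]
      rw [dif_pos hcard, goodPart_apply _ (hup _ _ (subset_insert _ _) hT) hcard]
    · rw [sum_eq_zero]
      · rcases d with _ | d
        · have : bdry V 0 c = 0 := by
            induction c using Finsupp.induction_linear with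
            | zero => simp
            | add f g hf hg => rw [map_add, hf, hg, add_zero]
            | single S a =>
              rw [bdry, Finsupp.lift_apply, Finsupp.sum_single_index (by simp)]
              rw [sum_eq_zero, smul_zero]
              intro s hs
              rw [dif_neg, smul_zero]
              rw [card_erase_of_mem hs, S.2]
              simp
          rw [this, map_zero]; rfl
        · exact goodPart_apply_of_not _ fun h => hc h.2
      · intro s hs
        rw [goodPart_apply_of_not, mul_zero]
        rintro ⟨-, h⟩
        rw [card_insert_of_notMem (by simpa using hs)] at h
        omega
  · rw [familyBdry_apply_notMem (F := {S | good S}) hT]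
    exact goodPart_apply_of_not _ fun h => hT h.1

lemma mem_cycles_iff_s2 (hup : ∀ S T, S ⊆ T → good S → good T) (hne : ¬ good ∅) {d : ℕ}
    (c : Chain V d) :
    c ∈ cycles V good d ↔ familyBdry {S | good S} (goodPart good d c) = 0 := by
  rw [cycles, Submodule.mem_comap, ← goodPart_eq_zero_iff, goodPart_bdry hup hne]

lemma mem_boundaries_iff (hup : ∀ S T, S ⊆ T → good S → good T) (hne : ¬ good ∅) {d : ℕ}
    (c : Chain V d) :
    c ∈ badChains V good d ⊔ LinearMap.range (bdry V (d + 1)) ↔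
      ∃ w ∈ familyChains {S | good S}, goodPart good d c = familyBdry {S | good S} w := by
  constructor
  · intro h
    obtain ⟨b, hb, _, ⟨w, rfl⟩, rfl⟩ := Submodule.mem_sup.mp h
    refine ⟨goodPart good (d + 1) w, goodPart_mem w, ?_⟩
    rw [← goodPart_bdry hup hne, map_add, (goodPart_eq_zero_iff b).mpr hb, zero_add]
    rfl
  · rintro ⟨w, hw, h⟩
    let b : Chain V d := bdry V (d + 1) (chainOf (d + 1) w)
    refine Submodule.mem_sup.mpr ⟨c - b, ?_, b, ⟨chainOf (d + 1) w, rfl⟩, sub_add_cancel _ _⟩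
    rw [← goodPart_eq_zero_iff, map_sub, sub_eq_zero]
    refine Eq.trans ?_ (goodPart_bdry hup hne (chainOf (d + 1) w)).symm
    rw [goodPart_chainOf hw]
    funext T
    rw [familyBdry_sizePart, ← h]
    split_ifs with hT
    · rfl
    · exact goodPart_apply_of_not _ fun h' => hT (by omega)

lemma homology_of_homologyFreeAt (hup : ∀ S T, S ⊆ T → good S → good T) (hne : ¬ good ∅)
    {d r : ℕ} (h : HomologyFreeAt {S | good S} (d + 1) r) :
    (∀ i, i ≠ d → Subsingleton (homology V good i)) ∧
      Nonempty (homology V good d ≃ₗ[ℤ] (Fin r → ℤ)) := by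
  obtain ⟨ι, _, z, hr, hzF, hzn, hz, hspan, hind⟩ := h
  constructor
  · intro i hi
    rw [Submodule.Quotient.subsingleton_iff, eq_top_iff]
    rintro ⟨c, hc⟩ -
    rw [Submodule.mem_comap, Submodule.subtype_apply, mem_boundaries_iff hup hne]
    obtain ⟨l, w, hw, hlw⟩ := hspan _ (goodPart_mem c) ((mem_cycles_iff_s2 hup hne c).mp hc)
    refine ⟨sizePart (i + 1 + 1) w, sizePart_mem hw, ?_⟩
    funext T
    rw [familyBdry_sizePart]
    split_ifs with hT
    · rw [hlw]
      simp only [Pi.add_apply, Finset.sum_apply, Pi.smul_apply]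
      rw [sum_eq_zero, zero_add]
      intro j _
      rw [← hzn j, sizePart_apply, if_neg (by omega), smul_zero]
    · exact goodPart_apply_of_not _ fun h' => hT (by omega)
  · have hgood : ∀ l : ι → ℤ,
        goodPart good d (chainOf d (∑ i, l i • z i)) = ∑ i, l i • z i := by
      intro l
      rw [goodPart_chainOf (Submodule.sum_smul_mem _ _ fun i _ => hzF i)]
      funext S
      rw [sizePart_apply]
      simp only [Finset.sum_apply, Pi.smul_apply]
      split_ifs with hS
      · rfl
      · refine (sum_eq_zero fun i _ => ?_).symm
        rw [← hzn i, sizePart_apply, if_neg hS, smul_zero]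
    let φ : (ι → ℤ) →ₗ[ℤ] cycles V good d :=
      LinearMap.codRestrict _ (chainOf d ∘ₗ Fintype.linearCombination ℤ z) fun l => by
        rw [mem_cycles_iff_s2 hup hne]
        simp only [LinearMap.comp_apply, Fintype.linearCombination_apply]
        rw [hgood, map_sum]
        exact sum_eq_zero fun i _ => by rw [map_smul, hz, smul_zero]
    have hφ : ∀ l, goodPart good d (φ l : Chain V d) = ∑ i, l i • z i := hgood
    let ψ := (Submodule.comap (cycles V good d).subtype
      (badChains V good d ⊔ LinearMap.range (bdry V (d + 1)))).mkQ ∘ₗ φ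
    have hψ : Function.Bijective ψ := by
      constructor
      · rw [← LinearMap.ker_eq_bot, LinearMap.ker_eq_bot']
        intro l hl
        rw [LinearMap.comp_apply, Submodule.mkQ_apply, Submodule.Quotient.mk_eq_zero,
          Submodule.mem_comap, Submodule.subtype_apply, mem_boundaries_iff hup hne] at hl
        obtain ⟨w, hw, hlw⟩ := hl
        exact hind l w hw (by rw [← hφ, hlw])
      · intro q
        obtain ⟨⟨c, hc⟩, rfl⟩ := Submodule.mkQ_surjective _ q
        obtain ⟨l, w, hw, hlw⟩ := hspan _ (goodPart_mem c) ((mem_cycles_iff_s2 hup hne c).mp hc)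
        refine ⟨l, ?_⟩
        rw [LinearMap.comp_apply, Submodule.mkQ_apply, Submodule.mkQ_apply,
          Submodule.Quotient.eq, Submodule.mem_comap, Submodule.subtype_apply,
          mem_boundaries_iff hup hne]
        refine ⟨-w, Submodule.neg_mem _ hw, ?_⟩
        rw [AddSubgroupClass.coe_sub, map_sub, hφ, hlw, map_neg]
        abel
    exact ⟨(LinearEquiv.ofBijective ψ hψ).symm.trans
      (LinearEquiv.funCongrLeft ℤ ℤ (Fintype.equivFinOfCardEq hr).symm)⟩

end Transfer

section CutConnected

variable {α : Type} {G H : SimpleGraph α} {W : Set α}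

/-- Connectedness of the graph induced on `W`, in terms of cuts. -/
def CutConn (G : SimpleGraph α) (W : Set α) : Prop :=
  W.Nonempty ∧ ∀ U : Set α, (∃ u ∈ W, u ∈ U) → (∃ v ∈ W, v ∉ U) →
    ∃ u ∈ W, ∃ v ∈ W, u ∈ U ∧ v ∉ U ∧ G.Adj u v

/-- Two-connectedness of the graph induced on `W`. -/
def TwoConnOn (G : SimpleGraph α) (W : Set α) : Prop :=
  CutConn G W ∧ ∀ v ∈ W, CutConn G (W \ {v})

lemma CutConn.mono (hW : CutConn G W) (h : ∀ u ∈ W, ∀ v ∈ W, G.Adj u v → H.Adj u v) :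
    CutConn H W := by
  refine ⟨hW.1, fun U h₁ h₂ => ?_⟩
  obtain ⟨u, hu, v, hv, hU, hV, hadj⟩ := hW.2 U h₁ h₂
  exact ⟨u, hu, v, hv, hU, hV, h u hu v hv hadj⟩

lemma TwoConnOn.mono (hW : TwoConnOn G W) (h : ∀ u ∈ W, ∀ v ∈ W, G.Adj u v → H.Adj u v) :
    TwoConnOn H W :=
  ⟨hW.1.mono h, fun v hv => (hW.2 v hv).mono fun u hu w hw => h u hu.1 w hw.1⟩

lemma CutConn.insert (hW : CutConn G W) {y u : α} (hu : u ∈ W) (h : G.Adj y u) :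
    CutConn G (insert y W) := by
  refine ⟨Set.insert_nonempty _ _, fun U h₁ h₂ => ?_⟩
  by_cases h₃ : (∃ u ∈ W, u ∈ U) ∧ ∃ v ∈ W, v ∉ U
  · obtain ⟨u, hu, v, hv, hU⟩ := hW.2 U h₃.1 h₃.2
    exact ⟨u, Or.inr hu, v, Or.inr hv, hU⟩
  · have hs := h.symm
    by_cases hy : y ∈ U
    · refine ⟨y, Or.inl rfl, u, Or.inr hu, hy, ?_, h⟩
      grind
    · refine ⟨u, Or.inr hu, y, Or.inl rfl, ?_, hy, hs⟩
      grind

lemma CutConn.exists_adj (hW : CutConn G W) {u v : α} (hu : u ∈ W) (hv : v ∈ W) (huv : u ≠ v) :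
    ∃ w ∈ W, w ≠ u ∧ G.Adj u w := by
  obtain ⟨p, hp, w, hw, hpu, hwu, h⟩ := hW.2 {u} ⟨u, hu, rfl⟩ ⟨v, hv, huv.symm⟩
  obtain rfl : p = u := hpu
  exact ⟨w, hw, hwu, h⟩

lemma TwoConnOn.insert_iff (hW : TwoConnOn G W) (hW2 : W.Nontrivial) {a : α} (ha : a ∉ W) :
    TwoConnOn G (insert a W) ↔ ∃ u ∈ W, ∃ v ∈ W, u ≠ v ∧ G.Adj a u ∧ G.Adj a v := by
  have hdiff : ∀ v ∈ W, (insert a W) \ {v} = insert a (W \ {v}) := by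
    intro v hv
    ext w
    simp only [Set.mem_sdiff, Set.mem_insert_iff, Set.mem_singleton_iff]
    grind
  constructor
  · intro h
    obtain ⟨w, hw⟩ := hW.1.1
    obtain ⟨u, hu, hua, hau⟩ := h.1.exists_adj (Or.inl rfl) (Or.inr hw) fun h => ha (h ▸ hw)
    have huW : u ∈ W := hu.resolve_left hua
    obtain ⟨t, htW, htu⟩ := hW2.exists_ne u
    have hc := h.2 u hu
    rw [hdiff u huW] at hc
    obtain ⟨v, hv, hva, hav⟩ := hc.exists_adj (Or.inl rfl) (Or.inr ⟨htW, htu⟩)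
      fun h => ha (h ▸ htW)
    have hvW := hv.resolve_left hva
    exact ⟨u, huW, v, hvW.1, Ne.symm hvW.2, hau, hav⟩
  · rintro ⟨u, hu, v, hv, huv, hau, hav⟩
    refine ⟨hW.1.insert hu hau, ?_⟩
    rintro w (rfl | hw)
    · rw [Set.insert_sdiff_of_mem _ (Set.mem_singleton _), Set.sdiff_singleton_eq_self ha]
      exact hW.1
    · rw [hdiff w hw]
      by_cases huw : u = w
      · exact (hW.2 w hw).insert ⟨hv, fun h => huv (huw.trans h.symm)⟩ hav
      · exact (hW.2 w hw).insert ⟨hu, huw⟩ hau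

lemma TwoConnOn.cutConn_of_insert {a : α} (h : TwoConnOn G (insert a W)) (ha : a ∉ W) :
    CutConn G W := by
  have := h.2 a (Or.inl rfl)
  rwa [Set.insert_sdiff_of_mem _ (Set.mem_singleton _), Set.sdiff_singleton_eq_self ha] at this

/-- Deleting an edge from `a` to a cut vertex `x` of `G - a` preserves two-connectedness. -/
lemma TwoConnOn.delete_edge {a x : α} (hG : TwoConnOn G (insert a W)) (ha : a ∉ W) (hx : x ∈ W)
    (hW2 : W.Nontrivial) (hcut : ¬ CutConn G (W \ {x}))
    (hH : ∀ u v, G.Adj u v → H.Adj u v ∨ (u = a ∧ v = x) ∨ (u = x ∧ v = a)) :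
    TwoConnOn H (insert a W) := by
  have hxa : x ≠ a := fun h => ha (h ▸ hx)
  have hWG : CutConn G W := hG.cutConn_of_insert ha
  have hWH : CutConn H W := hWG.mono fun u hu v hv h => by
    have := hH u v h; grind
  have hxH : CutConn H (insert a W \ {x}) := (hG.2 x (Or.inr hx)).mono fun u hu v hv h => by
    have := hH u v h
    simp only [Set.mem_sdiff, Set.mem_singleton_iff] at hu hv
    grind
  obtain ⟨t, htW, htx⟩ := hW2.exists_ne x
  have hinsert : insert x (insert a W \ {x}) = insert a W := by
    ext w
    simp only [Set.mem_sdiff, Set.mem_insert_iff, Set.mem_singleton_iff]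
    grind
  refine ⟨?_, ?_⟩
  · obtain ⟨y, hy, hyx, hxy⟩ := hWH.exists_adj hx htW htx.symm
    have := hxH.insert (y := x) (u := y) ⟨Or.inr hy, hyx⟩ hxy
    rwa [hinsert] at this
  rintro v hv
  by_cases hva : v = a
  · subst hva
    rwa [Set.insert_sdiff_of_mem _ (Set.mem_singleton _), Set.sdiff_singleton_eq_self ha]
  by_cases hvx : v = x
  · rwa [hvx]
  have hvW : v ∈ W := hv.resolve_left hva
  -- a side `P` of the cut at `x` that does not contain `v`
  obtain ⟨P, hPW, hPne, hxP, hvP, hPc⟩ : ∃ P : Set α, P ⊆ W ∧ P.Nonempty ∧ x ∉ P ∧ v ∉ P ∧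
      ∀ p ∈ P, ∀ q ∈ W, q ≠ x → G.Adj p q → q ∈ P := by
    have : ∃ U : Set α, (∃ u ∈ W \ {x}, u ∈ U) ∧ (∃ u ∈ W \ {x}, u ∉ U) ∧
        ∀ u ∈ W \ {x}, ∀ w ∈ W \ {x}, u ∈ U → w ∉ U → ¬ G.Adj u w := by
      by_contra hcon
      push Not at hcon
      exact hcut ⟨⟨t, htW, htx⟩, fun U h₁ h₂ => by
        obtain ⟨u, hu, w, hw, h⟩ := hcon U h₁ h₂
        exact ⟨u, hu, w, hw, h⟩⟩
    obtain ⟨U, ⟨p, hp, hpU⟩, ⟨q, hq, hqU⟩, hU⟩ := this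
    by_cases hvU : v ∈ U
    · refine ⟨(W \ {x}) \ U, fun w hw => hw.1.1, ⟨q, hq, hqU⟩, fun h => h.1.2 rfl,
        fun h => h.2 hvU, fun r hr s hs hsx hrs => ⟨⟨hs, hsx⟩, fun hsU => ?_⟩⟩
      exact hU s ⟨hs, hsx⟩ r hr.1 hsU hr.2 hrs.symm
    · refine ⟨(W \ {x}) ∩ U, fun w hw => hw.1.1, ⟨p, hp, hpU⟩, fun h => h.1.2 rfl,
        fun h => hvU h.2, fun r hr s hs hsx hrs => ⟨⟨hs, hsx⟩, ?_⟩⟩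
      by_contra hsU
      exact hU r hr.1 s ⟨hs, hsx⟩ hr.2 hsU hrs
  -- a cut `D` containing `x` and not `a`, crossed by no edge of `H`, is impossible
  have key : ∀ D : Set α, x ∈ D → a ∉ D → ∃ u ∈ insert a W \ {v}, ∃ w ∈ insert a W \ {v},
      u ∈ D ∧ w ∉ D ∧ H.Adj u w := by
    intro D hxD haD
    by_contra hcon
    push Not at hcon
    have hPD : ∀ p ∈ P, p ∉ D := by
      intro p hp hpD
      obtain ⟨u, hu, w, hw, huP, hwP, huw⟩ := (hG.2 x (Or.inr hx)).2 (P ∩ D)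
        ⟨p, ⟨Or.inr (hPW hp), fun h => hxP (h ▸ hp)⟩, hp, hpD⟩
        ⟨a, ⟨Or.inl rfl, hxa.symm⟩, fun h => haD h.2⟩
      have huW := hPW huP.1
      have hux : u ≠ x := fun h => hxP (h ▸ huP.1)
      have huv : u ≠ v := fun h => hvP (h ▸ huP.1)
      have hHuw : H.Adj u w := by
        rcases hH u w huw with h | h | h
        exacts [h, (ha (h.1 ▸ huW)).elim, (hux h.1).elim]
      rcases hw.1 with rfl | hwW
      · exact hcon u ⟨Or.inr huW, huv⟩ w ⟨Or.inl rfl, Ne.symm hva⟩ huP.2 haD hHuw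
      · have hwP' : w ∈ P := hPc u huP.1 w hwW hw.2 huw
        exact hcon u ⟨Or.inr huW, huv⟩ w ⟨Or.inr hwW, fun h => hvP (h ▸ hwP')⟩ huP.2
          (fun h => hwP ⟨hwP', h⟩) hHuw
    obtain ⟨p₀, hp₀⟩ := hPne
    obtain ⟨p, hpW, q, hqW, hpP, hqP, hpq⟩ := hWG.2 P ⟨p₀, hPW hp₀, hp₀⟩ ⟨x, hx, hxP⟩
    obtain rfl : q = x := by_contra fun hqx => hqP (hPc p hpP q hqW hqx hpq)
    replace hpq : H.Adj p q := by
      rcases hH p q hpq with h | h | h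
      exacts [h, (ha (h.1 ▸ hpW)).elim, (ha (h.2 ▸ hqW)).elim]
    exact hcon q ⟨Or.inr hqW, Ne.symm hvx⟩ p ⟨Or.inr hpW, fun h => hvP (h ▸ hpP)⟩ hxD
      (hPD p hpP) hpq.symm
  refine ⟨⟨a, Or.inl rfl, Ne.symm hva⟩, fun U h₁ h₂ => ?_⟩
  by_cases hxU : x ∈ U <;> by_cases haU : a ∈ U
  · obtain ⟨u, hu, w, hw, huU, hwU, huw⟩ := (hG.2 v hv).2 U h₁ h₂
    have := hH u w huw
    exact ⟨u, hu, w, hw, huU, hwU, by grind⟩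
  · exact key U hxU haU
  · obtain ⟨u, hu, w, hw, huU, hwU, huw⟩ := key Uᶜ hxU fun h => h haU
    exact ⟨w, hw, u, hu, not_not.mp hwU, huU, huw.symm⟩
  · obtain ⟨u, hu, w, hw, huU, hwU, huw⟩ := (hG.2 v hv).2 U h₁ h₂
    have := hH u w huw
    exact ⟨u, hu, w, hw, huU, hwU, by grind⟩

lemma connected_iff_cutConn_univ : G.Connected ↔ CutConn G Set.univ := by
  constructor
  · intro h
    have := h.nonempty
    refine ⟨Set.univ_nonempty, fun U ⟨u, _, hu⟩ ⟨v, _, hv⟩ => ?_⟩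
    obtain ⟨p⟩ := h.preconnected u v
    obtain ⟨d, -, h₁, h₂⟩ := p.exists_boundary_dart U hu hv
    exact ⟨d.fst, trivial, d.snd, trivial, h₁, h₂, d.adj⟩
  · intro h
    have : Nonempty α := h.1.to_type
    refine ⟨fun u v => ?_⟩
    by_contra hv
    obtain ⟨p, -, q, -, hp, hq, hpq⟩ :=
      h.2 {w | G.Reachable u w} ⟨u, trivial, SimpleGraph.Reachable.refl u⟩ ⟨v, trivial, hv⟩
    exact hq (SimpleGraph.Reachable.trans hp hpq.reachable)

lemma induce_connected_iff : (G.induce W).Connected ↔ CutConn G W := by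
  rw [connected_iff_cutConn_univ]
  constructor
  · rintro ⟨⟨w, -⟩, h⟩
    refine ⟨⟨w.1, w.2⟩, fun U ⟨u, hu, huU⟩ ⟨v, hv, hvU⟩ => ?_⟩
    obtain ⟨p, -, q, -, hp, hq, hpq⟩ :=
      h (Subtype.val ⁻¹' U) ⟨⟨u, hu⟩, trivial, huU⟩ ⟨⟨v, hv⟩, trivial, hvU⟩
    exact ⟨p.1, p.2, q.1, q.2, hp, hq, hpq⟩
  · rintro ⟨⟨w, hw⟩, h⟩
    refine ⟨⟨⟨w, hw⟩, trivial⟩, fun U ⟨u, _, huU⟩ ⟨v, _, hvU⟩ => ?_⟩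
    obtain ⟨p, hpW, q, hqW, ⟨p', hp, rfl⟩, hq, hpq⟩ :=
      h (Subtype.val '' U) ⟨u.1, u.2, u, huU, rfl⟩
        ⟨v.1, v.2, fun ⟨v', hv', hvv⟩ => hvU (Subtype.ext hvv ▸ hv')⟩
    exact ⟨p', trivial, ⟨q, hqW⟩, trivial, hp, fun hqU => hq ⟨⟨q, hqW⟩, hqU, rfl⟩, hpq⟩

end CutConnected

section Filtration

variable {V : Type} [LinearOrder V] [Fintype V] {F : Set (Finset V)}

lemma homologyFreeAt_empty (n : ℕ) : HomologyFreeAt (∅ : Set (Finset V)) n 0 :=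
  ⟨Empty, inferInstance, Empty.elim, rfl, fun i => i.elim, fun i => i.elim, fun i => i.elim,
    fun c hc _ => ⟨Empty.elim, 0, Submodule.zero_mem _, by
      funext S; simpa using hc S (Set.notMem_empty S)⟩,
    fun _ _ _ _ => funext fun i => i.elim⟩

lemma homologyFreeAt_filtration {n r : ℕ} (hF : F.OrdConnected) (f : ℕ → Set (Finset V))
    (h0 : f 0 = ∅) (hsub : ∀ m, f m ⊆ F) (hmono : ∀ m, f m ⊆ f (m + 1))
    (hlow : ∀ m, ∀ S ∈ f m, ∀ T ∈ F, T ⊆ S → T ∈ f m) (N : ℕ)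
    (h : ∀ m < N, HomologyFreeAt (f (m + 1) \ f m) n r) : HomologyFreeAt (f N) n (N * r) := by
  induction N with
  | zero => rw [h0, zero_mul]; exact homologyFreeAt_empty n
  | succ N ih =>
    have hconv : (f (N + 1)).OrdConnected := ⟨fun S hS T hT U hU =>
      hlow _ T hT U (hF.out (hsub _ hS) (hsub _ hT) hU) hU.2⟩
    rw [add_mul, one_mul]
    exact homologyFreeAt_union hconv (hmono N)
      (fun S hS T hT hTS => hlow N S hS T (hsub _ hT) hTS)
      (ih fun m hm => h m (by omega)) (h N (by omega))

end Filtration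

section GraphFamilies

variable {k : ℕ}

lemma graphOf_adj_iff {S : Finset (Edge k)} {u v : Fin k} (h : u < v) :
    (graphOf k S).Adj u v ↔ (⟨(u, v), h⟩ : Edge k) ∈ S := by
  rw [graphOf, SimpleGraph.fromEdgeSet_adj]
  constructor
  · rintro ⟨⟨⟨⟨p, q⟩, hpq⟩, hp, heq⟩, -⟩
    rcases Sym2.eq_iff.mp heq with ⟨rfl, rfl⟩ | ⟨rfl, rfl⟩
    · exact hp
    · exact absurd h (not_lt.mpr (le_of_lt hpq))
  · intro hS
    exact ⟨⟨_, hS, rfl⟩, h.ne⟩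

lemma graphOf_mono {S T : Finset (Edge k)} (h : S ⊆ T) {u v : Fin k}
    (hadj : (graphOf k S).Adj u v) : (graphOf k T).Adj u v := by
  rw [graphOf, SimpleGraph.fromEdgeSet_adj] at *
  obtain ⟨⟨p, hp, heq⟩, hne⟩ := hadj
  exact ⟨⟨p, h hp, heq⟩, hne⟩

lemma graphOf_insert_adj {S : Finset (Edge k)} {a b u v : Fin k} (hab : a < b) :
    (graphOf k (insert ⟨(a, b), hab⟩ S)).Adj u v ↔
      (graphOf k S).Adj u v ∨ (u = a ∧ v = b) ∨ (u = b ∧ v = a) := by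
  rcases lt_trichotomy u v with h | rfl | h
  · rw [graphOf_adj_iff h, graphOf_adj_iff h, mem_insert, Subtype.mk.injEq, Prod.mk.injEq]
    grind
  · simp only [SimpleGraph.irrefl, false_or, false_iff]
    grind
  · rw [SimpleGraph.adj_comm, SimpleGraph.adj_comm (graphOf k S), graphOf_adj_iff h,
      graphOf_adj_iff h, mem_insert, Subtype.mk.injEq, Prod.mk.injEq]
    grind

/-- The first `j` nodes. -/
def firstNodes (k j : ℕ) : Set (Fin k) := {v | v.val < j}

/-- Every node `i ≥ j` has exactly the nodes `0` and `x i` as smaller neighbours. -/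
def TailFixed (j : ℕ) (x : Fin k → Fin k) (S : Finset (Edge k)) : Prop :=
  ∀ i : Fin k, j ≤ i.val → ∀ u < i, (graphOf k S).Adj u i ↔ (u.val = 0 ∨ u = x i)

/-- The graphs that are two-connected on the first `j` nodes, each further node being joined to
exactly the nodes `0` and `x i` among the smaller ones. -/
def graphFamily (j : ℕ) (x : Fin k → Fin k) : Set (Finset (Edge k)) :=
  {S | TwoConnOn (graphOf k S) (firstNodes k j) ∧ TailFixed j x S}

lemma firstNodes_succ {j : ℕ} (hj : j < k) :
    firstNodes k (j + 1) = insert ⟨j, hj⟩ (firstNodes k j) := by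
  ext v
  simp only [firstNodes, Set.mem_ofPred_eq, Set.mem_insert_iff, Fin.ext_iff]
  omega

lemma firstNodes_nontrivial {j : ℕ} (hj : 2 ≤ j) (hjk : j ≤ k) : (firstNodes k j).Nontrivial :=
  ⟨⟨0, by omega⟩, show 0 < j by omega, ⟨1, by omega⟩, show 1 < j by omega, by simp⟩

lemma TwoConnOn.graphOf_mono {S T : Finset (Edge k)} {W : Set (Fin k)} (h : S ⊆ T)
    (hS : TwoConnOn (graphOf k S) W) : TwoConnOn (graphOf k T) W :=
  hS.mono fun _ _ _ _ => _root_.graphOf_mono h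

lemma TailFixed.of_between {j : ℕ} {x : Fin k → Fin k} {S T U : Finset (Edge k)}
    (hS : TailFixed j x S) (hT : TailFixed j x T) (hSU : S ⊆ U) (hUT : U ⊆ T) :
    TailFixed j x U := fun i hi u hu =>
  ⟨fun h => (hT i hi u hu).mp (graphOf_mono hUT h),
    fun h => graphOf_mono hSU ((hS i hi u hu).mpr h)⟩

lemma ordConnected_twoConnOn_inter_tailFixed (W : Set (Fin k)) {j : ℕ} {x : Fin k → Fin k} :
    {S | TwoConnOn (graphOf k S) W ∧ TailFixed j x S}.OrdConnected :=
  ⟨fun _ hS _ hT _ hU => ⟨hS.1.graphOf_mono hU.1, hS.2.of_between hT.2 hU.1 hU.2⟩⟩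

lemma tailFixed_insert_iff {j : ℕ} {x : Fin k → Fin k} {S : Finset (Edge k)} {a b : Fin k}
    (hab : a < b) (hb : b.val < j) :
    TailFixed j x (insert ⟨(a, b), hab⟩ S) ↔ TailFixed j x S := by
  refine forall_congr' fun i => forall_congr' fun hi => forall_congr' fun u =>
    forall_congr' fun hu => ?_
  rw [graphOf_insert_adj]
  have : ¬ ((u = a ∧ i = b) ∨ (u = b ∧ i = a)) := by
    rintro (⟨-, rfl⟩ | ⟨-, rfl⟩)
    · omega
    · have : i.val < b.val := hab
      omega
  rw [or_iff_left this]

lemma graphOf_insert_adj_of_mem {j : ℕ} {S : Finset (Edge k)} {a b u v : Fin k} (hab : a < b)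
    (hb : b.val = j) (hu : u ∈ firstNodes k j) (hv : v ∈ firstNodes k j) :
    (graphOf k (insert ⟨(a, b), hab⟩ S)).Adj u v ↔ (graphOf k S).Adj u v := by
  have hu' : u.val < j := hu
  have hv' : v.val < j := hv
  rw [graphOf_insert_adj, or_iff_left]
  rintro (⟨-, rfl⟩ | ⟨rfl, -⟩) <;> omega

lemma cutConn_insert_iff {j : ℕ} {S : Finset (Edge k)} {a b : Fin k} (hab : a < b)
    (hb : b.val = j) {W : Set (Fin k)} (hW : W ⊆ firstNodes k j) :
    CutConn (graphOf k (insert ⟨(a, b), hab⟩ S)) W ↔ CutConn (graphOf k S) W :=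
  ⟨fun h => h.mono fun _ hu _ hv => (graphOf_insert_adj_of_mem hab hb (hW hu) (hW hv)).mp,
    fun h => h.mono fun _ hu _ hv => (graphOf_insert_adj_of_mem hab hb (hW hu) (hW hv)).mpr⟩

lemma twoConnOn_insert_iff {j : ℕ} {S : Finset (Edge k)} {a b : Fin k} (hab : a < b)
    (hb : b.val = j) : TwoConnOn (graphOf k (insert ⟨(a, b), hab⟩ S)) (firstNodes k j) ↔
      TwoConnOn (graphOf k S) (firstNodes k j) :=
  and_congr (cutConn_insert_iff hab hb subset_rfl) (forall_congr' fun _ => forall_congr' fun _ =>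
    cutConn_insert_iff hab hb Set.sdiff_subset)

lemma homologyFreeAt_of_toggle_edge {F : Set (Finset (Edge k))} (e : Edge k) (n : ℕ)
    (h : ∀ S, insert e S ∈ F ↔ S ∈ F) : HomologyFreeAt F n 0 :=
  homologyFreeAt_of_toggle e n fun S _ => by convert h S

/-- The members of `graphFamily (j + 1) x` in which one of the first `m` nodes is a cut vertex of
the graph on the first `j` nodes. -/
def cutFamily (j : ℕ) (x : Fin k → Fin k) (m : ℕ) : Set (Finset (Edge k)) :=
  {S | S ∈ graphFamily (j + 1) x ∧ ∃ v : Fin k, v.val < m ∧ v ∈ firstNodes k j ∧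
    ¬ CutConn (graphOf k S) (firstNodes k j \ {v})}

lemma cutFamily_lower {j m : ℕ} {x : Fin k → Fin k} : ∀ S ∈ cutFamily j x m,
    ∀ T ∈ graphFamily (j + 1) x, T ⊆ S → T ∈ cutFamily j x m := by
  rintro S ⟨-, v, hv, hvj, hcut⟩ T hT hTS
  exact ⟨hT, v, hv, hvj, fun h => hcut (h.mono fun _ _ _ _ => graphOf_mono hTS)⟩

lemma homologyFreeAt_cutFamily {j : ℕ} (hj : 2 ≤ j) (hjk : j < k) (x : Fin k → Fin k) (n : ℕ) :
    HomologyFreeAt (cutFamily j x j) n 0 := by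
  have hnm : (⟨j, hjk⟩ : Fin k) ∉ firstNodes k j := lt_irrefl j
  rw [← mul_zero j]
  refine homologyFreeAt_filtration (ordConnected_twoConnOn_inter_tailFixed _) (cutFamily j x) ?_
    (fun m S hS => hS.1) (fun m S ⟨hS, v, hv, h⟩ => ⟨hS, v, by omega, h⟩)
    (fun m => cutFamily_lower) j fun m hm => ?_
  · ext S
    simp [cutFamily]
  · have hma : (⟨m, by omega⟩ : Fin k) < ⟨j, hjk⟩ := hm
    have hmem : ∀ S, S ∈ cutFamily j x (m + 1) \ cutFamily j x m ↔
        S ∈ graphFamily (j + 1) x ∧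
        ¬ CutConn (graphOf k S) (firstNodes k j \ {⟨m, by omega⟩}) ∧
        ∀ v : Fin k, v.val < m → CutConn (graphOf k S) (firstNodes k j \ {v}) := by
      intro S
      constructor
      · rintro ⟨⟨hS, v, hv, hvj, hcut⟩, hnot⟩
        have hlt : ∀ v : Fin k, v.val < m → CutConn (graphOf k S) (firstNodes k j \ {v}) :=
          fun w hw => by_contra fun h => hnot ⟨hS, w, hw, lt_trans hw hm, h⟩
        have hvm : v = ⟨m, by omega⟩ :=
          Fin.ext (le_antisymm (Nat.lt_succ_iff.mp hv) (not_lt.mp fun h => hcut (hlt v h)))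
        exact ⟨hS, hvm ▸ hcut, hlt⟩
      · rintro ⟨hS, hcut, hlt⟩
        exact ⟨⟨hS, _, Nat.lt_succ_self m, hm, hcut⟩, fun ⟨_, v, hv, _, h⟩ => h (hlt v hv)⟩
    refine homologyFreeAt_of_toggle_edge ⟨(⟨m, by omega⟩, ⟨j, hjk⟩), hma⟩ n fun S => ?_
    rw [hmem, hmem]
    have hc : ∀ v, CutConn (graphOf k (insert ⟨(⟨m, by omega⟩, ⟨j, hjk⟩), hma⟩ S))
        (firstNodes k j \ {v}) ↔ CutConn (graphOf k S) (firstNodes k j \ {v}) := fun v =>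
      cutConn_insert_iff hma rfl Set.sdiff_subset
    simp only [hc]
    refine and_congr_left fun ⟨hcut, _⟩ => and_congr ?_
      (tailFixed_insert_iff hma (Nat.lt_succ_self j))
    refine ⟨fun h => ?_, fun h => h.graphOf_mono (subset_insert _ _)⟩
    rw [firstNodes_succ hjk] at *
    refine h.delete_edge hnm (x := ⟨m, by omega⟩) hm (firstNodes_nontrivial hj hjk.le)
      ((hc _).not.mpr hcut) fun u v huv => ?_
    rw [graphOf_insert_adj] at huv
    tauto

/-- The members of `graphFamily (j + 1) x` that are two-connected on the first `j` nodes. -/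
def coneFamily (j : ℕ) (x : Fin k → Fin k) : Set (Finset (Edge k)) :=
  graphFamily (j + 1) x \ cutFamily j x j

lemma mem_coneFamily_iff {j : ℕ} (hj : 2 ≤ j) (hjk : j < k) {x : Fin k → Fin k}
    {S : Finset (Edge k)} : S ∈ coneFamily j x ↔
      (TwoConnOn (graphOf k S) (firstNodes k j) ∧ TailFixed (j + 1) x S) ∧
      ∃ u ∈ firstNodes k j, ∃ v ∈ firstNodes k j, u ≠ v ∧
        (graphOf k S).Adj u ⟨j, hjk⟩ ∧ (graphOf k S).Adj v ⟨j, hjk⟩ := by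
  have hnm : (⟨j, hjk⟩ : Fin k) ∉ firstNodes k j := lt_irrefl j
  have hadj : ∀ u : Fin k, (graphOf k S).Adj u ⟨j, hjk⟩ ↔ (graphOf k S).Adj ⟨j, hjk⟩ u :=
    fun u => SimpleGraph.adj_comm _ _ _
  simp only [hadj]
  constructor
  · rintro ⟨⟨h, ht⟩, hnot⟩
    have h' := h
    rw [firstNodes_succ hjk] at h
    have h2 : TwoConnOn (graphOf k S) (firstNodes k j) :=
      ⟨h.cutConn_of_insert hnm, fun v hv => by_contra fun hcut =>
        hnot ⟨⟨h', ht⟩, v, hv, hv, hcut⟩⟩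
    exact ⟨⟨h2, ht⟩, (h2.insert_iff (firstNodes_nontrivial hj hjk.le) hnm).mp h⟩
  · rintro ⟨⟨h2, ht⟩, h⟩
    refine ⟨⟨?_, ht⟩, fun ⟨_, v, _, hv, hcut⟩ => hcut (h2.2 v hv)⟩
    rw [firstNodes_succ hjk]
    exact (h2.insert_iff (firstNodes_nontrivial hj hjk.le) hnm).mpr h

lemma coneFamily_ordConnected {j : ℕ} {x : Fin k → Fin k} :
    (coneFamily j x).OrdConnected := by
  refine ⟨fun S hS T hT U hU => ?_⟩
  have hUF : U ∈ graphFamily (j + 1) x :=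
    (ordConnected_twoConnOn_inter_tailFixed _).out hS.1 hT.1 hU
  exact ⟨hUF, fun h => hS.2 (cutFamily_lower U h S hS.1 hU.1)⟩

/-- The members of `coneFamily j x` in which the smaller neighbours of node `j` are `0` and a
node `y` with `0 < y ≤ m`. -/
def pairFamily (j : ℕ) (hjk : j < k) (x : Fin k → Fin k) (m : ℕ) : Set (Finset (Edge k)) :=
  {S | S ∈ coneFamily j x ∧ ∃ y : Fin k, 0 < y.val ∧ y.val ≤ m ∧ y.val < j ∧
    ∀ u < (⟨j, hjk⟩ : Fin k), (graphOf k S).Adj u ⟨j, hjk⟩ ↔ (u.val = 0 ∨ u = y)}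

lemma pairFamily_lower {j m : ℕ} (hj : 2 ≤ j) (hjk : j < k) {x : Fin k → Fin k} :
    ∀ S ∈ pairFamily j hjk x m, ∀ T ∈ coneFamily j x, T ⊆ S → T ∈ pairFamily j hjk x m := by
  rintro S ⟨-, y, hy, hym, hyj, hadj⟩ T hT hTS
  refine ⟨hT, y, hy, hym, hyj, fun u hu => ⟨fun h => (hadj u hu).mp (graphOf_mono hTS h), ?_⟩⟩
  obtain ⟨-, p, hp, q, hq, hpq, hpa, hqa⟩ := (mem_coneFamily_iff hj hjk).mp hT
  have hp' := (hadj p hp).mp (graphOf_mono hTS hpa)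
  have hq' := (hadj q hq).mp (graphOf_mono hTS hqa)
  intro h
  have hpq' : p.val ≠ q.val := fun h => hpq (Fin.ext h)
  have : u = p ∨ u = q := by
    simp only [Fin.ext_iff] at *
    omega
  rcases this with rfl | rfl
  exacts [hpa, hqa]

lemma pairFamily_sdiff {j m : ℕ} (hj : 2 ≤ j) (hjk : j < k) (hm : m < j - 1)
    (x : Fin k → Fin k) : pairFamily j hjk x (m + 1) \ pairFamily j hjk x m =
      graphFamily j (Function.update x ⟨j, hjk⟩ ⟨m + 1, by omega⟩) := by
  have htail : ∀ S y, TailFixed j (Function.update x ⟨j, hjk⟩ y) S ↔ TailFixed (j + 1) x S ∧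
      ∀ u < (⟨j, hjk⟩ : Fin k), (graphOf k S).Adj u ⟨j, hjk⟩ ↔ (u.val = 0 ∨ u = y) := by
    intro S y
    constructor
    · intro h
      refine ⟨fun i hi u hu => ?_, fun u hu => ?_⟩
      · have := h i (by omega) u hu
        rwa [Function.update_of_ne (by rintro rfl; simp at hi)] at this
      · have := h ⟨j, hjk⟩ le_rfl u hu
        rwa [Function.update_self] at this
    · rintro ⟨h₁, h₂⟩ i hi u hu
      by_cases hij : i = ⟨j, hjk⟩
      · subst hij
        rw [Function.update_self]
        exact h₂ u hu
      · rw [Function.update_of_ne hij]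
        refine h₁ i ?_ u hu
        rw [Fin.ext_iff] at hij
        exact Nat.lt_of_le_of_ne hi (Ne.symm hij)
  ext S
  constructor
  · rintro ⟨⟨hS, y, hy, hym, hyj, hadj⟩, hnot⟩
    have hy' : y = ⟨m + 1, by omega⟩ := Fin.ext (le_antisymm hym
      (not_lt.mp fun h => hnot ⟨hS, y, hy, Nat.lt_succ_iff.mp h, hyj, hadj⟩))
    obtain ⟨⟨h₁, h₂⟩, -⟩ := (mem_coneFamily_iff hj hjk).mp hS
    exact ⟨h₁, (htail S _).mpr ⟨h₂, hy' ▸ hadj⟩⟩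
  · rintro ⟨h₁, h₂⟩
    obtain ⟨h₂, hadj⟩ := (htail S _).mp h₂
    have h0 : (⟨0, by omega⟩ : Fin k) < ⟨j, hjk⟩ := show 0 < j by omega
    have hm1 : (⟨m + 1, by omega⟩ : Fin k) < ⟨j, hjk⟩ := show m + 1 < j by omega
    have hm1a := (hadj _ hm1).mpr (Or.inr rfl)
    refine ⟨⟨(mem_coneFamily_iff hj hjk).mpr ⟨⟨h₁, h₂⟩, _, h0, _, hm1, by simp,
      (hadj _ h0).mpr (Or.inl rfl), hm1a⟩, _, Nat.succ_pos m, le_rfl, hm1, hadj⟩, ?_⟩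
    rintro ⟨-, y, hy, hym, hyj, hadj'⟩
    have := (hadj' _ hm1).mp hm1a
    simp only [Fin.ext_iff] at this
    omega

lemma homologyFreeAt_coneFamily_sdiff {j : ℕ} (hj : 2 ≤ j) (hjk : j < k) (x : Fin k → Fin k)
    (n : ℕ) : HomologyFreeAt (coneFamily j x \ pairFamily j hjk x (j - 1)) n 0 := by
  have hmem : ∀ S, S ∈ coneFamily j x \ pairFamily j hjk x (j - 1) ↔
      (TwoConnOn (graphOf k S) (firstNodes k j) ∧ TailFixed (j + 1) x S) ∧
      ∃ u ∈ firstNodes k j, ∃ v ∈ firstNodes k j, u ≠ v ∧ u.val ≠ 0 ∧ v.val ≠ 0 ∧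
        (graphOf k S).Adj u ⟨j, hjk⟩ ∧ (graphOf k S).Adj v ⟨j, hjk⟩ := by
    intro S
    constructor
    · rintro ⟨hS, hnot⟩
      obtain ⟨h, u, hu, v, hv, huv, hua, hva⟩ := (mem_coneFamily_iff hj hjk).mp hS
      refine ⟨h, ?_⟩
      have third : ∀ p ∈ firstNodes k j, ∀ q ∈ firstNodes k j, p.val = 0 → q ≠ p →
          (graphOf k S).Adj p ⟨j, hjk⟩ → (graphOf k S).Adj q ⟨j, hjk⟩ →
          ∃ t ∈ firstNodes k j, t.val ≠ 0 ∧ t ≠ q ∧ (graphOf k S).Adj t ⟨j, hjk⟩ := by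
        intro p hp q hq hp0 hqp hpa hqa
        have hqj : q.val < j := hq
        by_contra hcon
        push Not at hcon
        refine hnot ⟨hS, q, ?_, by omega, hqj, fun t ht => ⟨fun hta => ?_, ?_⟩⟩
        · rw [Ne, Fin.ext_iff] at hqp
          omega
        · by_contra hne
          rw [not_or] at hne
          exact hcon t ht hne.1 hne.2 hta
        · rintro (ht0 | rfl)
          · rwa [show t = p from Fin.ext (ht0.trans hp0.symm)]
          · exact hqa
      by_cases hu0 : u.val = 0
      · obtain ⟨t, ht, ht0, htv, hta⟩ := third u hu v hv hu0 huv.symm hua hva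
        have hv0 : v.val ≠ 0 := fun h => huv (Fin.ext (hu0.trans h.symm))
        exact ⟨t, ht, v, hv, htv, ht0, hv0, hta, hva⟩
      · by_cases hv0 : v.val = 0
        · obtain ⟨t, ht, ht0, htu, hta⟩ := third v hv u hu hv0 huv hva hua
          exact ⟨t, ht, u, hu, htu, ht0, hu0, hta, hua⟩
        · exact ⟨u, hu, v, hv, huv, hu0, hv0, hua, hva⟩
    · rintro ⟨h, u, hu, v, hv, huv, hu0, hv0, hua, hva⟩
      refine ⟨(mem_coneFamily_iff hj hjk).mpr ⟨h, u, hu, v, hv, huv, hua, hva⟩, ?_⟩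
      rintro ⟨-, y, -, -, -, hadj⟩
      have h₁ := ((hadj u hu).mp hua).resolve_left hu0
      have h₂ := ((hadj v hv).mp hva).resolve_left hv0
      exact huv (h₁.trans h₂.symm)
  have h0 : (⟨0, by omega⟩ : Fin k) < ⟨j, hjk⟩ := show 0 < j by omega
  refine homologyFreeAt_of_toggle_edge ⟨(⟨0, by omega⟩, ⟨j, hjk⟩), h0⟩ n fun S => ?_
  rw [hmem, hmem, twoConnOn_insert_iff (j := j) h0 rfl, tailFixed_insert_iff h0 (Nat.lt_succ_self j)]
  have hadj : ∀ u ∈ firstNodes k j, u.val ≠ 0 →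
      ((graphOf k (insert ⟨(⟨0, by omega⟩, ⟨j, hjk⟩), h0⟩ S)).Adj u ⟨j, hjk⟩ ↔
        (graphOf k S).Adj u ⟨j, hjk⟩) := by
    intro u hu hu0
    rw [graphOf_insert_adj, or_iff_left]
    rintro (⟨rfl, -⟩ | ⟨rfl, -⟩)
    · exact hu0 rfl
    · exact lt_irrefl j hu
  refine and_congr_right fun _ => ?_
  constructor
  · rintro ⟨u, hu, v, hv, huv, hu0, hv0, hua, hva⟩
    exact ⟨u, hu, v, hv, huv, hu0, hv0, (hadj u hu hu0).mp hua, (hadj v hv hv0).mp hva⟩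
  · rintro ⟨u, hu, v, hv, huv, hu0, hv0, hua, hva⟩
    exact ⟨u, hu, v, hv, huv, hu0, hv0, (hadj u hu hu0).mpr hua, (hadj v hv hv0).mpr hva⟩

lemma homologyFreeAt_graphFamily_succ {j n r : ℕ} (hj : 2 ≤ j) (hjk : j < k) (x : Fin k → Fin k)
    (h : ∀ y : Fin k, 0 < y.val → y.val < j →
      HomologyFreeAt (graphFamily j (Function.update x ⟨j, hjk⟩ y)) n r) :
    HomologyFreeAt (graphFamily (j + 1) x) n ((j - 1) * r) := by
  have hpair : HomologyFreeAt (pairFamily j hjk x (j - 1)) n ((j - 1) * r) := by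
    refine homologyFreeAt_filtration coneFamily_ordConnected (pairFamily j hjk x) ?_
      (fun m S hS => hS.1) (fun m S ⟨hS, y, h₁, h₂, h₃⟩ => ⟨hS, y, h₁, by omega, h₃⟩)
      (fun m => pairFamily_lower hj hjk) (j - 1) fun m hm => ?_
    · ext S
      simp only [pairFamily, Set.mem_ofPred_eq, Set.mem_empty_iff_false, iff_false]
      rintro ⟨-, y, h₁, h₂, -⟩
      omega
    · rw [pairFamily_sdiff hj hjk hm]
      exact h _ (Nat.succ_pos m) (show m + 1 < j by omega)
  have hcone : HomologyFreeAt (coneFamily j x) n ((j - 1) * r + 0) :=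
    homologyFreeAt_union coneFamily_ordConnected (fun S hS => hS.1) (pairFamily_lower hj hjk)
      hpair (homologyFreeAt_coneFamily_sdiff hj hjk x n)
  have := homologyFreeAt_union (ordConnected_twoConnOn_inter_tailFixed _) (fun S hS => hS.1)
    cutFamily_lower (homologyFreeAt_cutFamily hj hjk x n) hcone
  rwa [zero_add, add_zero] at this

lemma homologyFreeAt_graphFamily_two (hk : 2 ≤ k) (x : Fin k → Fin k)
    (hx : ∀ i : Fin k, 2 ≤ i.val → 0 < (x i).val ∧ x i < i) :
    HomologyFreeAt (graphFamily 2 x) (2 * k - 3) 1 := by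
  let S₀ : Finset (Edge k) := univ.filter fun e =>
    e.1.2.val = 1 ∨ (2 ≤ e.1.2.val ∧ (e.1.1.val = 0 ∨ e.1.1 = x e.1.2))
  have hS₀ : ∀ e : Edge k, e ∈ S₀ ↔
      e.1.2.val = 1 ∨ (2 ≤ e.1.2.val ∧ (e.1.1.val = 0 ∨ e.1.1 = x e.1.2)) := by simp [S₀]
  have h01 : (⟨0, by omega⟩ : Fin k) < ⟨1, by omega⟩ := Nat.zero_lt_one
  have htwo : ∀ S : Finset (Edge k), TwoConnOn (graphOf k S) (firstNodes k 2) ↔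
      (graphOf k S).Adj ⟨0, by omega⟩ ⟨1, by omega⟩ := by
    intro S
    have hnodes : ∀ v ∈ firstNodes k 2, v = ⟨0, by omega⟩ ∨ v = ⟨1, by omega⟩ := by
      intro v hv
      have : v.val < 2 := hv
      simp only [Fin.ext_iff]
      omega
    constructor
    · intro h
      obtain ⟨w, hw, hne, hadj⟩ := h.1.exists_adj (u := ⟨0, by omega⟩) (v := ⟨1, by omega⟩)
        Nat.two_pos Nat.one_lt_two (by simp)
      rwa [(hnodes w hw).resolve_left hne] at hadj
    · intro h
      have hsub : ∀ v : Fin k, CutConn (graphOf k S) {v} := fun v =>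
        ⟨⟨v, rfl⟩, fun U ⟨u, hu, huU⟩ ⟨w, hw, hwU⟩ => (hwU (by
          obtain rfl : u = v := hu
          obtain rfl : w = u := hw
          exact huU)).elim⟩
      have h2 : firstNodes k 2 = {⟨0, by omega⟩, ⟨1, by omega⟩} :=
        Set.Subset.antisymm hnodes (by rintro v (rfl | rfl); exacts [Nat.two_pos, Nat.one_lt_two])
      rw [h2]
      refine ⟨(hsub _).insert rfl h, ?_⟩
      rintro v (rfl | rfl)
      · rw [Set.insert_sdiff_of_mem _ (Set.mem_singleton _), Set.sdiff_singleton_eq_self (by simp)]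
        exact hsub _
      · rw [Set.pair_comm, Set.insert_sdiff_of_mem _ (Set.mem_singleton _),
          Set.sdiff_singleton_eq_self (by simp)]
        exact hsub _
  have hfam : graphFamily 2 x = {S₀} := by
    ext S
    rw [Set.mem_singleton_iff]
    constructor
    · rintro ⟨h, ht⟩
      rw [htwo, graphOf_adj_iff h01] at h
      ext ⟨⟨u, v⟩, huv⟩
      have huv' : u.val < v.val := huv
      rw [hS₀]
      by_cases hv : 2 ≤ v.val
      · rw [← graphOf_adj_iff, ht v hv u huv]
        have : v.val ≠ 1 := by omega
        simp [this, hv]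
      · have hv1 : v.val = 1 := by omega
        have he : (⟨(u, v), huv⟩ : Edge k) = ⟨(⟨0, by omega⟩, ⟨1, by omega⟩), h01⟩ :=
          Subtype.ext (Prod.ext (Fin.ext (show u.val = 0 by omega)) (Fin.ext hv1))
        rw [he]
        simp [h]
    · rintro rfl
      refine ⟨(htwo _).mpr ?_, fun i hi u hu => ?_⟩
      · rw [graphOf_adj_iff h01, hS₀]
        exact Or.inl rfl
      · have : i.val ≠ 1 := by omega
        rw [graphOf_adj_iff hu, hS₀]
        simp [this, hi]
  have hcard : S₀.card = 2 * k - 3 := by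
    have hfib : ∀ i : Fin k, (S₀.filter fun e => e.1.2 = i).card =
        if i.val = 0 then 0 else if i.val = 1 then 1 else 2 := by
      intro i
      split_ifs with h0 h1
      · rw [card_eq_zero, filter_eq_empty_iff]
        rintro ⟨⟨u, v⟩, huv⟩ - rfl
        exact absurd (show u.val < v.val from huv) (by simp only at h0; omega)
      · rw [card_eq_one]
        refine ⟨⟨(⟨0, by omega⟩, ⟨1, by omega⟩), h01⟩, ?_⟩
        ext ⟨⟨u, v⟩, huv⟩
        have huv' : u.val < v.val := huv
        simp only [mem_filter, hS₀, mem_singleton, Subtype.mk.injEq, Prod.mk.injEq, Fin.ext_iff]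
        omega
      · have hi : 2 ≤ i.val := by omega
        have h0i : (⟨0, by omega⟩ : Fin k) < i := show 0 < i.val by omega
        rw [card_eq_two]
        refine ⟨⟨(⟨0, by omega⟩, i), h0i⟩, ⟨(x i, i), (hx i hi).2⟩, ?_, ?_⟩
        · have := (hx i hi).1
          simp only [ne_eq, Subtype.mk.injEq, Prod.mk.injEq, Fin.ext_iff]
          omega
        · ext ⟨⟨u, v⟩, huv⟩
          simp only [mem_filter, hS₀, mem_singleton, mem_insert, Subtype.mk.injEq, Prod.mk.injEq]
          constructor
          · rintro ⟨h | ⟨-, h⟩, rfl⟩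
            · omega
            · exact h.imp (fun h => ⟨Fin.ext h, rfl⟩) fun h => ⟨h, rfl⟩
          · rintro (⟨rfl, rfl⟩ | ⟨rfl, rfl⟩)
            · exact ⟨Or.inr ⟨hi, Or.inl rfl⟩, rfl⟩
            · exact ⟨Or.inr ⟨hi, Or.inr rfl⟩, rfl⟩
    rw [card_eq_sum_card_fiberwise (f := fun e : Edge k => e.1.2) (t := univ) (by simp),
      sum_congr rfl fun i _ => hfib i,
      Fin.sum_univ_eq_sum_range fun i => if i = 0 then 0 else if i = 1 then 1 else 2]
    clear * - hk
    induction k, hk using Nat.le_induction with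
    | base => rfl
    | succ k hk ih =>
      rw [sum_range_succ, ih, if_neg (by omega), if_neg (by omega)]
      omega
  rw [hfam, ← hcard]
  exact homologyFreeAt_singleton S₀

lemma homologyFreeAt_graphFamily {j : ℕ} (hj : 2 ≤ j) : j ≤ k → ∀ x : Fin k → Fin k,
    (∀ i : Fin k, j ≤ i.val → 0 < (x i).val ∧ x i < i) →
    HomologyFreeAt (graphFamily j x) (2 * k - 3) (Nat.factorial (j - 2)) := by
  induction j, hj using Nat.le_induction with
  | base => exact fun hk x hx => homologyFreeAt_graphFamily_two hk x hx
  | succ j hj ih =>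
    intro hjk x hx
    have hfact : (j + 1 - 2).factorial = (j - 1) * (j - 2).factorial := by
      obtain ⟨m, rfl⟩ : ∃ m, j = m + 2 := ⟨j - 2, by omega⟩
      exact Nat.factorial_succ m
    rw [hfact]
    refine homologyFreeAt_graphFamily_succ hj hjk x fun y hy hyj => ih (by omega) _ fun i hi => ?_
    by_cases hij : i = ⟨j, hjk⟩
    · subst hij
      rw [Function.update_self]
      exact ⟨hy, hyj⟩
    · rw [Function.update_of_ne hij]
      rw [Fin.ext_iff] at hij
      exact hx i (Nat.lt_of_le_of_ne hi (Ne.symm hij))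

lemma isTwoConn_iff (S : Finset (Edge k)) :
    IsTwoConn k S ↔ TwoConnOn (graphOf k S) Set.univ := by
  rw [IsTwoConn, TwoConnOn, connected_iff_cutConn_univ]
  refine and_congr_right fun _ => forall_congr' fun v => ?_
  rw [induce_connected_iff]
  have : {u | u ≠ v} = Set.univ \ {v} := by ext; simp
  rw [this]
  simp

end GraphFamilies

/-- For every `k ≥ 2`, the homology of the complex `Δ²(k)` of
two-connected graphs vanishes in every degree `i ≠ 2k − 4`, and
`H_{2k−4}(Δ²(k))` is free abelian of rank `(k−2)!`. -/
theorem homology_two_connected_graph_complex (k : ℕ) (hk : 2 ≤ k) :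
    (∀ i : ℕ, i ≠ 2 * k - 4 → Subsingleton (homology (Edge k) (IsTwoConn k) i)) ∧
    Nonempty (homology (Edge k) (IsTwoConn k) (2 * k - 4) ≃ₗ[ℤ]
      (Fin (Nat.factorial (k - 2)) → ℤ)) := by
  have hfam : {S | IsTwoConn k S} = graphFamily k (fun i => i) := by
    ext S
    have hfirst : firstNodes k k = Set.univ := Set.eq_univ_of_forall fun v => v.2
    rw [Set.mem_ofPred_eq, isTwoConn_iff, graphFamily, Set.mem_ofPred_eq, hfirst]
    exact (and_iff_left fun i hi => absurd i.2 (not_lt.mpr hi)).symm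
  have hfree : HomologyFreeAt {S | IsTwoConn k S} (2 * k - 4 + 1) (Nat.factorial (k - 2)) := by
    rw [hfam, show 2 * k - 4 + 1 = 2 * k - 3 by omega]
    exact homologyFreeAt_graphFamily hk le_rfl _ fun i hi => absurd i.2 (not_lt.mpr hi)
  refine homology_of_homologyFreeAt (fun S T hST hS => ?_) (fun h => ?_) hfree
  · rw [isTwoConn_iff] at *
    exact hS.graphOf_mono hST
  · rw [isTwoConn_iff] at h
    obtain ⟨w, -, -, hadj⟩ := h.1.exists_adj (u := (⟨0, by omega⟩ : Fin k)) (v := ⟨1, by omega⟩)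
      (Set.mem_univ _) (Set.mem_univ _) (by simp)
    simp [graphOf] at hadj

end
end
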